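/- Let G be a finite connected bipartite d-regular simple graph with g vertices and h = dg/2 edges, d ≥ 3, with adjacency matrix A, and let A' be obtained from A by deleting the row and column of one fixed vertex. For each positive integer n let S_n = Σ_ℓ n!^{g−h} Π_{e ∈ E(G)} (n−ℓ_e)!/ℓ_e!, where the sum is over all vectors ℓ ∈ ℤ^{E(G)} with 0 ≤ ℓ_e ≤ n for all e and Σ_{e ∋ v} ℓ_e = n for every vertex v. Then, as n → ∞ along multiples of d, S_n ∼ [(d−1)^{(d−1)g/2 + 1/2} / ((d(d−2))^{dg/4 − g/2 + 1/2} · det(A' + dI')^{1/2})] · (2πn)^{1/2} · ((d−1)^{d−1}/d^{d−2})^{gn/2}, where I' is the identity matrix of size g − 1. -/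

import Mathlib

section

open MeasureTheory Filter Topology

/-- The cell of points whose scaled floor is a given integer vector is a box. -/
lemma setOf_floor_mul_eq {ι : Type*} {a : ℝ} (ha : 0 < a) (t : ι → ℤ) :
    {s : ι → ℝ | (fun i => ⌊a * s i⌋) = t} =
      Set.univ.pi fun i => Set.Ico ((t i : ℝ) / a) (((t i : ℝ) + 1) / a) := by
  ext s
  simp only [Set.mem_ofPred_eq, Set.mem_univ_pi, Set.mem_Ico, funext_iff, Int.floor_eq_iff,
    div_le_iff₀ ha, lt_div_iff₀ ha, mul_comm a]

lemma measurable_floor_mul {ι : Type*} (a : ℝ) :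
    Measurable fun s : ι → ℝ => fun i => ⌊a * s i⌋ :=
  measurable_pi_lambda _ fun i =>
    (Measurable.const_mul (measurable_pi_apply (X := fun _ => ℝ) i) a).floor

/-- A finite sum over the integer lattice as the integral of a step function. -/
lemma integral_comp_floor_mul {ι : Type*} [Fintype ι] {a : ℝ} (ha : 0 < a)
    (W : (ι → ℤ) → ℝ) (T : Finset (ι → ℤ)) (hT : ∀ t ∉ T, W t = 0) :
    ∫ s : ι → ℝ, W (fun i => ⌊a * s i⌋) = (∑ t ∈ T, W t) / a ^ Fintype.card ι := by
  classical
  have hcell : ∀ t : ι → ℤ, MeasurableSet {s : ι → ℝ | (fun i => ⌊a * s i⌋) = t} := fun t => by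
    rw [setOf_floor_mul_eq ha]
    exact MeasurableSet.univ_pi fun i => measurableSet_Ico
  have hvol : ∀ t : ι → ℤ, volume {s : ι → ℝ | (fun i => ⌊a * s i⌋) = t}
      = ENNReal.ofReal ((a ^ Fintype.card ι)⁻¹) := fun t => by
    rw [setOf_floor_mul_eq ha, Real.volume_pi_Ico]
    have : ∀ i, ((t i : ℝ) + 1) / a - (t i : ℝ) / a = a⁻¹ := fun i => by field_simp; ring
    simp only [this, Finset.prod_const, Finset.card_univ]
    rw [← ENNReal.ofReal_pow (by positivity), inv_pow]
  have hsum : ∀ s : ι → ℝ, W (fun i => ⌊a * s i⌋) =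
      ∑ t ∈ T, Set.indicator {s : ι → ℝ | (fun i => ⌊a * s i⌋) = t} (fun _ => W t) s := by
    intro s
    simp only [Set.indicator_apply, Set.mem_ofPred_eq]
    rw [Finset.sum_ite_eq]
    split_ifs with h
    · rfl
    · exact hT _ h
  simp_rw [hsum]
  rw [integral_finsetSum]
  · rw [Finset.sum_div]
    refine Finset.sum_congr rfl fun t _ => ?_
    rw [integral_indicator (hcell t), setIntegral_const, Measure.real, hvol,
      ENNReal.toReal_ofReal (by positivity), smul_eq_mul]
    ring
  · intro t _
    refine IntegrableOn.integrable_indicator ?_ (hcell t)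
    refine integrableOn_const ?_ ?_
    · rw [hvol]; exact ENNReal.ofReal_ne_top
    · simp

/-- Dominated convergence for rescaled sums over the integer lattice. -/
lemma tendsto_lattice_sum {ι : Type*} [Fintype ι] (a : ℕ → ℝ) (ha : Tendsto a atTop atTop)
    (W : ℕ → (ι → ℤ) → ℝ) (T : ℕ → Finset (ι → ℤ)) (hT : ∀ q, ∀ t ∉ T q, W q t = 0)
    (φ : (ι → ℝ) → ℝ)
    (hlim : ∀ (t : ℕ → ι → ℤ) (s : ι → ℝ),
      (∀ i, Tendsto (fun q => (t q i : ℝ) / a q) atTop (𝓝 (s i))) →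
      Tendsto (fun q => W q (t q)) atTop (𝓝 (φ s)))
    (C c : ℝ) (hc : 0 < c)
    (hbound : ∀ᶠ q in atTop, ∀ t, |W q t| ≤ C * Real.exp (-c * ∑ i, ((t i : ℝ) / a q) ^ 2)) :
    Tendsto (fun q => (∑ t ∈ T q, W q t) / a q ^ Fintype.card ι) atTop (𝓝 (∫ s, φ s)) := by
  have hfloor : ∀ x y : ℝ, 1 ≤ x → |(⌊x * y⌋ : ℝ) / x - y| ≤ 1 / x := by
    intro x y hx
    have hx0 : 0 < x := by linarith
    have h1 := Int.floor_le (x * y)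
    have h2 := Int.lt_floor_add_one (x * y)
    rw [show (⌊x * y⌋ : ℝ) / x - y = (⌊x * y⌋ - x * y) / x by field_simp, abs_div, abs_of_pos hx0]
    gcongr
    rw [abs_le]; constructor <;> linarith
  have key : Tendsto (fun q => ∫ s : ι → ℝ, W q (fun i => ⌊a q * s i⌋)) atTop
      (𝓝 (∫ s, φ s)) := by
    refine tendsto_integral_filter_of_dominated_convergence
      (fun s => |C| * Real.exp (c * Fintype.card ι) * ∏ i, Real.exp (-(c / 2) * (s i) ^ 2))
      ?_ ?_ ?_ ?_
    · exact Eventually.of_forall fun q =>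
        ((measurable_of_countable (W q)).comp (measurable_floor_mul (a q))).aestronglyMeasurable
    · filter_upwards [hbound, ha.eventually_ge_atTop 1] with q hq hq1
      refine Eventually.of_forall fun s => ?_
      refine (hq _).trans ?_
      rw [← Real.exp_sum, mul_assoc, ← Real.exp_add]
      refine mul_le_mul (le_abs_self C) (Real.exp_le_exp.2 ?_) (Real.exp_pos _).le (abs_nonneg C)
      have : ∀ i, (s i) ^ 2 / 2 - 1 ≤ ((⌊a q * s i⌋ : ℝ) / a q) ^ 2 := by
        intro i
        have h1 := hfloor (a q) (s i) hq1
        have h2 : 1 / a q ≤ 1 := by rw [div_le_one (by linarith)]; exact hq1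
        have h3 := abs_le.1 (h1.trans h2)
        set u := (⌊a q * s i⌋ : ℝ) / a q
        nlinarith [sq_nonneg (u + (u - s i))]
      have h := Finset.sum_le_sum fun i (_ : i ∈ Finset.univ) => this i
      rw [Finset.sum_sub_distrib, ← Finset.sum_div] at h
      simp only [Finset.sum_const, Finset.card_univ, nsmul_eq_mul, mul_one] at h
      rw [← Finset.mul_sum]
      nlinarith
    · refine Integrable.const_mul ?_ _
      exact Integrable.fintype_prod fun i => integrable_exp_neg_mul_sq (half_pos hc)
    · refine Eventually.of_forall fun s => hlim _ s fun i => ?_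
      rw [tendsto_iff_norm_sub_tendsto_zero]
      refine squeeze_zero' (Eventually.of_forall fun _ => norm_nonneg _) ?_
        (tendsto_const_nhds.div_atTop ha (a := (1 : ℝ)))
      filter_upwards [ha.eventually_ge_atTop 1] with q hq1
      exact hfloor _ _ hq1
  refine key.congr' ?_
  filter_upwards [ha.eventually_gt_atTop 0] with q hq
  exact integral_comp_floor_mul hq _ _ (hT q)

end

section

open Matrix MeasureTheory

open scoped MatrixOrder in
/-- The Gaussian integral of a positive definite quadratic form. -/
lemma integral_exp_neg_mul_dotProduct_mulVec {ι : Type*} [Fintype ι] [DecidableEq ι]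
    (Q : Matrix ι ι ℝ) (hQ : Q.PosDef) (b : ℝ) :
    ∫ s : ι → ℝ, Real.exp (-b * (s ⬝ᵥ Q *ᵥ s)) =
      √(Real.pi / b) ^ Fintype.card ι / √Q.det := by
  obtain ⟨R, hR⟩ := CStarAlgebra.nonneg_iff_eq_star_mul_self.1 hQ.posSemidef.nonneg
  rw [star_eq_conjTranspose, conjTranspose_eq_transpose_of_trivial] at hR
  have hdet : Q.det = R.det ^ 2 := by rw [hR, det_mul, det_transpose, sq]
  have hR0 : R.det ≠ 0 := by
    intro h
    have := hQ.det_pos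
    rw [hdet, h] at this
    simp at this
  have hquad : ∀ s : ι → ℝ, Real.exp (-b * (s ⬝ᵥ Q *ᵥ s)) =
      (fun u : ι → ℝ => ∏ i, Real.exp (-b * u i ^ 2)) (Matrix.toLin' R s) := by
    intro s
    simp only [← Real.exp_sum, ← Finset.mul_sum, toLin'_apply]
    congr 2
    rw [hR, ← mulVec_mulVec, dotProduct_mulVec, vecMul_transpose]
    simp [dotProduct, sq]
  simp_rw [hquad]
  have hmap := Real.map_matrix_volume_pi_eq_smul_volume_pi hR0
  have hmeas : Measurable (Matrix.toLin' R) :=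
    (LinearMap.continuous_of_finiteDimensional (Matrix.toLin' R)).measurable
  have hcont : Continuous fun u : ι → ℝ => ∏ i, Real.exp (-b * u i ^ 2) := by fun_prop
  rw [← integral_map hmeas.aemeasurable (hcont.aestronglyMeasurable), hmap, integral_smul_measure,
    ENNReal.toReal_ofReal (abs_nonneg _),
    integral_fintype_prod_volume_eq_pow (fun x : ℝ => Real.exp (-b * x ^ 2)),
    integral_gaussian, hdet, Real.sqrt_sq_eq_abs, abs_inv, smul_eq_mul]
  ring

/-- A unimodular complement relates the Gram determinants of a kernel basis and of the map. -/
lemma det_transpose_mul_self_eq_of_split {E ι κ : Type*} [Fintype E] [Fintype ι] [Fintype κ]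
    [DecidableEq E] [DecidableEq ι] [DecidableEq κ]
    (N : Matrix E ι ℤ) (M : Matrix ι E ℤ) (C : Matrix E κ ℤ) (B : Matrix κ E ℤ)
    (hMN : M * N = 1) (hMC : M * C = 0) (hBN : B * N = 0) (hBC : B * C = 1)
    (hsum : N * M + C * B = 1) :
    (Nᵀ * N).det = (B * Bᵀ).det := by
  set U : Matrix E (ι ⊕ κ) ℤ := fromCols N C
  set U' : Matrix (ι ⊕ κ) E ℤ := fromRows M B
  set P : Matrix E (ι ⊕ κ) ℤ := fromCols N Bᵀ
  have hUU' : U * U' = 1 := by rw [fromCols_mul_fromRows, hsum]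
  have hU'U : U' * U = 1 := by
    rw [fromRows_mul_fromCols, hMN, hMC, hBN, hBC, fromBlocks_one]
  have hCB : Cᵀ * Bᵀ = 1 := by rw [← transpose_mul, hBC, transpose_one]
  have hNB : Nᵀ * Bᵀ = 0 := by rw [← transpose_mul, hBN, transpose_zero]
  have h1 : (Uᵀ * P).det = (Nᵀ * N).det := by
    rw [transpose_fromCols, fromRows_mul_fromCols, hCB, hNB, det_fromBlocks_zero₁₂, det_one,
      mul_one]
  have h2 : (U' * P).det = (B * Bᵀ).det := by
    rw [fromRows_mul_fromCols, hMN, hBN, det_fromBlocks_zero₂₁, det_one, one_mul]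
  have h3 : (Uᵀ * P).det = (Uᵀ * U).det * (U' * P).det := by
    rw [← det_mul, Matrix.mul_assoc, ← Matrix.mul_assoc U, hUU', Matrix.one_mul]
  have h4 : (Uᵀ * U).det * (U' * U'ᵀ).det = 1 := by
    rw [← det_mul, Matrix.mul_assoc, ← Matrix.mul_assoc U, hUU', Matrix.one_mul,
      ← transpose_mul, hU'U, transpose_one, det_one]
  have h5 : 0 ≤ (Uᵀ * U).det := by
    have h := (posSemidef_conjTranspose_mul_self (U.map (Int.cast : ℤ → ℝ))).det_nonneg
    have : (U.map (Int.cast : ℤ → ℝ))ᴴ * U.map (Int.cast : ℤ → ℝ) =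
        (Uᵀ * U).map (Int.castRingHom ℝ) := by
      rw [Matrix.map_mul, conjTranspose_eq_transpose_of_trivial, transpose_map]
      rfl
    rw [this, ← RingHom.mapMatrix_apply, ← RingHom.map_det] at h
    rw [eq_intCast] at h
    exact_mod_cast h
  have h6 : (Uᵀ * U).det = 1 := by
    rcases Int.eq_one_or_neg_one_of_mul_eq_one h4 with h | h
    · exact h
    · rw [h] at h5; norm_num at h5
  rw [← h1, h3, h6, one_mul, h2]

/-- The number of columns of a kernel basis of a split surjection. -/
lemma card_add_card_eq_of_split {E ι κ : Type*} [Fintype E] [Fintype ι] [Fintype κ]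
    [DecidableEq E] [DecidableEq ι] [DecidableEq κ]
    (N : Matrix E ι ℤ) (M : Matrix ι E ℤ) (C : Matrix E κ ℤ) (B : Matrix κ E ℤ)
    (hMN : M * N = 1) (hBC : B * C = 1) (hsum : N * M + C * B = 1) :
    Fintype.card ι + Fintype.card κ = Fintype.card E := by
  have h := congrArg trace hsum
  rw [trace_add, trace_mul_comm N, trace_mul_comm C, hMN, hBC, trace_one, trace_one, trace_one] at h
  exact_mod_cast h

/-- A surjective integer matrix has an integral kernel basis with a complement. -/
lemma exists_split_of_surjective {E κ : Type*} [Fintype E] [Fintype κ]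
    [DecidableEq E] [DecidableEq κ] (B : Matrix κ E ℤ)
    (hB : Function.Surjective B.mulVec) :
    ∃ (r : ℕ) (N : Matrix E (Fin r) ℤ) (M : Matrix (Fin r) E ℤ) (C : Matrix E κ ℤ),
      M * N = 1 ∧ M * C = 0 ∧ B * N = 0 ∧ B * C = 1 ∧ N * M + C * B = 1 := by
  have hB' : Function.Surjective (toLin' B) := fun y => by
    obtain ⟨x, hx⟩ := hB y
    exact ⟨x, by rw [toLin'_apply, hx]⟩
  obtain ⟨c, hc⟩ := Module.projective_lifting_property (toLin' B) LinearMap.id hB'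
  obtain ⟨r, b⟩ := Submodule.basisOfPid (Pi.basisFun ℤ E) (LinearMap.ker (toLin' B))
  set n : (Fin r → ℤ) →ₗ[ℤ] (E → ℤ) :=
    (LinearMap.ker (toLin' B)).subtype ∘ₗ b.equivFun.symm.toLinearMap with hn
  have hBc : ∀ y, toLin' B (c y) = y := fun y => LinearMap.congr_fun hc y
  set p : (E → ℤ) →ₗ[ℤ] LinearMap.ker (toLin' B) :=
    (LinearMap.id - c ∘ₗ toLin' B).codRestrict _ (fun x => by
      simp [LinearMap.mem_ker, hBc, -toLin'_apply]) with hp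
  set m : (E → ℤ) →ₗ[ℤ] (Fin r → ℤ) := b.equivFun.toLinearMap ∘ₗ p with hm
  have hBn : ∀ t, toLin' B (n t) = 0 := fun t => (b.equivFun.symm t).2
  have hpval : ∀ x, (p x : E → ℤ) = x - c (toLin' B x) := fun x => rfl
  have hpn : ∀ t, p (n t) = b.equivFun.symm t := fun t => by
    apply Subtype.ext
    rw [hpval, hBn, map_zero, sub_zero]
    rfl
  have hmn : ∀ t, m (n t) = t := fun t => by
    change b.equivFun (p (n t)) = t
    rw [hpn, LinearEquiv.apply_symm_apply]
  have hpc : ∀ y, p (c y) = 0 := fun y => by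
    apply Subtype.ext
    rw [hpval, hBc, sub_self]
    rfl
  have hmc : ∀ y, m (c y) = 0 := fun y => by
    change b.equivFun (p (c y)) = 0
    rw [hpc, map_zero]
  have hnm : ∀ x, n (m x) = x - c (toLin' B x) := fun x => by
    change ((b.equivFun.symm (b.equivFun (p x)) : LinearMap.ker (toLin' B)) : E → ℤ) = _
    rw [LinearEquiv.symm_apply_apply, hpval]
  refine ⟨r, LinearMap.toMatrix' n, LinearMap.toMatrix' m, LinearMap.toMatrix' c, ?_, ?_, ?_, ?_, ?_⟩
  · rw [← LinearMap.toMatrix'_comp, show m ∘ₗ n = LinearMap.id from LinearMap.ext hmn,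
      LinearMap.toMatrix'_id]
  · rw [← LinearMap.toMatrix'_comp, show m ∘ₗ c = 0 from LinearMap.ext hmc, map_zero]
  · rw [← LinearMap.toMatrix'_toLin' B, ← LinearMap.toMatrix'_comp,
      show toLin' B ∘ₗ n = 0 from LinearMap.ext hBn, map_zero]
  · conv_lhs => rw [← LinearMap.toMatrix'_toLin' B]
    rw [← LinearMap.toMatrix'_comp, hc, LinearMap.toMatrix'_id]
  · conv_lhs => rw [← LinearMap.toMatrix'_toLin' B]
    rw [← LinearMap.toMatrix'_comp, ← LinearMap.toMatrix'_comp, ← map_add,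
      ← LinearMap.toMatrix'_id]
    congr 1
    refine LinearMap.ext fun x => ?_
    simp [hnm, -toLin'_apply]

/-- The incidence matrix of a graph, over its edges and its vertices other than `v₀`. -/
def reducedIncMatrix {V : Type*} [DecidableEq V] (G : SimpleGraph V) (v₀ : V) :
    Matrix {w : V // w ≠ v₀} G.edgeSet ℤ :=
  Matrix.of fun v e => if v.1 ∈ (e : Sym2 V) then 1 else 0

lemma sum_ite_mem_edge {V R : Type*} [Fintype V] [DecidableEq V] [AddCommMonoid R]
    {G : SimpleGraph V} {u w : V} (huw : G.Adj u w) (f : V → R) :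
    ∑ v, (if v ∈ s(u, w) then f v else 0) = f u + f w := by
  rw [← Finset.sum_filter, show Finset.univ.filter (fun v => v ∈ s(u, w)) = {u, w} by
    ext v; simp, Finset.sum_pair huw.ne]

lemma sum_sum_ite_mem_edge {V : Type*} [Fintype V] [DecidableEq V] {R : Type*} [CommRing R]
    (G : SimpleGraph V) [Fintype G.edgeSet] (x : G.edgeSet → R) :
    ∑ v, ∑ e : G.edgeSet, (if v ∈ (e : Sym2 V) then x e else 0) = 2 * ∑ e, x e := by
  rw [Finset.sum_comm, Finset.mul_sum]
  refine Finset.sum_congr rfl fun e _ => ?_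
  obtain ⟨e, he⟩ := e
  induction e using Sym2.ind with
  | _ u w =>
    rw [sum_ite_mem_edge (G := G) he (fun _ => x ⟨s(u, w), he⟩)]
    ring

/-- In a bipartite graph an edge vector with zero sums at all vertices but one has zero sums. -/
lemma sum_ite_mem_eq_zero_of_colorable {V : Type*} [Fintype V] [DecidableEq V]
    (G : SimpleGraph V) [Fintype G.edgeSet] (hbip : G.Colorable 2) (v₀ : V) (x : G.edgeSet → ℤ)
    (hx : ∀ v ≠ v₀, ∑ e : G.edgeSet, (if v ∈ (e : Sym2 V) then x e else 0) = 0) (v : V) :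
    ∑ e : G.edgeSet, (if v ∈ (e : Sym2 V) then x e else 0) = 0 := by
  obtain ⟨c⟩ := hbip
  set σ : V → ℤ := fun v => if c v = 0 then 1 else -1 with hσ
  have hσ0 : ∀ v, σ v ≠ 0 := fun v => by simp only [hσ]; split_ifs <;> norm_num
  have hadj : ∀ {u w}, G.Adj u w → σ u + σ w = 0 := fun {u w} h => by
    have hne := c.valid h
    simp only [hσ]
    generalize c u = a at *
    generalize c w = b at *
    revert hne
    revert a b
    decide
  have hsum : ∑ v, σ v * ∑ e : G.edgeSet, (if v ∈ (e : Sym2 V) then x e else 0) = 0 := by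
    simp_rw [Finset.mul_sum, mul_ite, mul_zero]
    rw [Finset.sum_comm]
    refine Finset.sum_eq_zero fun e _ => ?_
    obtain ⟨e, he⟩ := e
    induction e using Sym2.ind with
    | _ u w =>
      rw [sum_ite_mem_edge (G := G) he (fun v => σ v * x ⟨s(u, w), he⟩), ← add_mul, hadj he,
        zero_mul]
  by_cases hv : v = v₀
  · rw [Finset.sum_eq_single v₀ (fun w _ hw => by rw [hx w hw, mul_zero]) (by simp)] at hsum
    rw [hv]
    exact (mul_eq_zero.1 hsum).resolve_left (hσ0 v₀)
  · exact hx v hv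

lemma exists_edge_vector_of_walk {V : Type*} [DecidableEq V] (G : SimpleGraph V)
    [Fintype G.edgeSet] {u v : V} (p : G.Walk u v) :
    ∃ (a : ℤ) (x : G.edgeSet → ℤ), ∀ w,
      ∑ e : G.edgeSet, (if w ∈ (e : Sym2 V) then x e else 0) =
        (if w = u then 1 else 0) + a * (if w = v then 1 else 0) := by
  classical
  induction p with
  | nil => exact ⟨-1, 0, fun w => by simp; split_ifs <;> simp⟩
  | @cons u u' v h p ih =>
    obtain ⟨a, x, hx⟩ := ih
    refine ⟨-a, fun e => (if e = ⟨s(u, u'), h⟩ then 1 else 0) - x e, fun w => ?_⟩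
    have hsplit : ∀ e : G.edgeSet, (if w ∈ (e : Sym2 V) then
        (if e = ⟨s(u, u'), h⟩ then (1 : ℤ) else 0) - x e else 0) =
        (if e = ⟨s(u, u'), h⟩ then (if w ∈ (e : Sym2 V) then 1 else 0) else 0) -
          (if w ∈ (e : Sym2 V) then x e else 0) := fun e => by split_ifs <;> simp
    rw [Finset.sum_congr rfl fun e _ => hsplit e, Finset.sum_sub_distrib, hx,
      Finset.sum_ite_eq' Finset.univ]
    have hne := h.ne
    simp only [Finset.mem_univ, if_true, Sym2.mem_iff]
    by_cases h1 : w = u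
    · subst h1
      simp only [hne, if_true, if_false, true_or]
      ring
    · simp only [h1, if_false, false_or]
      ring

lemma reducedIncMatrix_mulVec {V : Type*} [DecidableEq V] (G : SimpleGraph V)
    [Fintype G.edgeSet] (v₀ : V) (x : G.edgeSet → ℤ) (v : {w : V // w ≠ v₀}) :
    (reducedIncMatrix G v₀ *ᵥ x) v =
      ∑ e : G.edgeSet, (if v.1 ∈ (e : Sym2 V) then x e else 0) := by
  simp [reducedIncMatrix, mulVec, dotProduct]

lemma reducedIncMatrix_surjective {V : Type*} [Fintype V] [DecidableEq V] (G : SimpleGraph V)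
    [Fintype G.edgeSet] (hconn : G.Connected) (v₀ : V) :
    Function.Surjective (reducedIncMatrix G v₀).mulVec := by
  intro y
  choose a x hx using fun u : V =>
    exists_edge_vector_of_walk G (hconn.preconnected u v₀).some
  have hx' : ∀ u : {w : V // w ≠ v₀}, reducedIncMatrix G v₀ *ᵥ x u = Pi.single u 1 := fun u => by
    funext v
    rw [reducedIncMatrix_mulVec, hx, if_neg v.2, mul_zero, add_zero, Pi.single_apply]
    simp only [Subtype.ext_iff]
  refine ⟨∑ u, y u • x u, ?_⟩
  rw [mulVec_sum]
  simp_rw [mulVec_smul, hx']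
  funext v
  simp [Finset.sum_apply, Pi.single_apply]

lemma sum_edgeSet_ite_mem {V R : Type*} [Fintype V] [DecidableEq V] [Semiring R]
    (G : SimpleGraph V) [DecidableRel G.Adj] [Fintype G.edgeSet] (v : V) (F : Sym2 V → R) :
    ∑ e : G.edgeSet, (if v ∈ (e : Sym2 V) then F e else 0) =
      ∑ e, G.incMatrix R v e * F e := by
  have h : ∀ e : Sym2 V, G.incMatrix R v e * F e =
      if e ∈ G.edgeSet then (if v ∈ e then F e else 0) else 0 := fun e => by
    by_cases h1 : e ∈ G.edgeSet <;> by_cases h2 : v ∈ e <;>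
      simp [SimpleGraph.incMatrix_apply', SimpleGraph.incidenceSet, h1, h2]
  simp_rw [h]
  rw [← Finset.sum_filter (fun e => e ∈ G.edgeSet)]
  refine (Finset.sum_subtype _ (p := fun e => e ∈ G.edgeSet) (fun e => by simp)
    (fun e => if v ∈ e then F e else 0)).symm

lemma card_filter_mem_edge {V : Type*} [Fintype V] [DecidableEq V] (G : SimpleGraph V)
    [DecidableRel G.Adj] [Fintype G.edgeSet] (v : V) :
    (Finset.univ.filter fun e : G.edgeSet => v ∈ (e : Sym2 V)).card = G.degree v := by
  have h := sum_edgeSet_ite_mem (R := ℕ) G v (fun _ => 1)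
  simp only [mul_one] at h
  rw [Finset.card_filter, h, SimpleGraph.sum_incMatrix_apply, Nat.cast_id]

lemma map_reducedIncMatrix_mul_transpose {V : Type*} [Fintype V] [DecidableEq V]
    (G : SimpleGraph V) [DecidableRel G.Adj] (d : ℕ) (hreg : G.IsRegularOfDegree d) (v₀ : V) :
    (reducedIncMatrix G v₀ * (reducedIncMatrix G v₀)ᵀ).map (Int.castRingHom ℝ) =
      Matrix.of fun i j : {w : V // w ≠ v₀} =>
        (G.adjMatrix ℝ + (d : ℝ) • (1 : Matrix V V ℝ)) i.1 j.1 := by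
  have h : reducedIncMatrix G v₀ * (reducedIncMatrix G v₀)ᵀ =
      Matrix.of fun i j : {w : V // w ≠ v₀} =>
        (G.incMatrix ℤ * (G.incMatrix ℤ)ᵀ) i.1 j.1 := by
    ext i j
    rw [of_apply, mul_apply, mul_apply]
    simp only [transpose_apply (G.incMatrix ℤ)]
    rw [← sum_edgeSet_ite_mem G i.1 (fun e => G.incMatrix ℤ j.1 e)]
    refine Finset.sum_congr rfl fun e _ => ?_
    simp only [reducedIncMatrix, of_apply, transpose_apply, ite_mul, one_mul, zero_mul,
      SimpleGraph.incMatrix_apply', SimpleGraph.incidenceSet, Set.mem_ofPred_eq, e.2, true_and]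
  rw [h, SimpleGraph.incMatrix_mul_transpose]
  ext i j
  simp only [map_apply, of_apply, Matrix.add_apply, Matrix.smul_apply, SimpleGraph.adjMatrix_apply, one_apply,
    hreg.degree_eq, smul_eq_mul]
  by_cases hij : i.1 = j.1
  · simp [hij]
  · simp only [hij, if_false, mul_zero, add_zero]
    split_ifs <;> simp

end

section

open Filter Topology Real
open scoped Nat

/-- The exponential rate of `(n - ℓ)! / ℓ!` at `ℓ = n x`. -/
noncomputable def edgeRate (x : ℝ) : ℝ := negMulLog x - negMulLog (1 - x)

lemma edgeRate_zero : edgeRate 0 = 0 := by simp [edgeRate]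

lemma continuous_edgeRate : Continuous edgeRate := by
  unfold edgeRate
  fun_prop

lemma hasDerivAt_edgeRate {x : ℝ} (hx : x ≠ 0) (hx1 : x ≠ 1) :
    HasDerivAt edgeRate (-log x - log (1 - x) - 2) x := by
  have h1 := hasDerivAt_negMulLog hx
  have h2 := (hasDerivAt_negMulLog (sub_ne_zero.2 hx1.symm)).comp x
    ((hasDerivAt_id x).const_sub 1)
  refine (h1.sub h2).congr_deriv ?_
  ring

/-- Strong concavity of the rate at a point below `1 / 3`, seen from the interval `[0, 1 / 2]`. -/
lemma edgeRate_le_tangent {p x : ℝ} (hp : 0 < p) (hp3 : p ≤ 1 / 3) (hx : 0 ≤ x)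
    (hx2 : x ≤ 1 / 2) :
    edgeRate x ≤ edgeRate p + (-log p - log (1 - p) - 2) * (x - p) - 1 / 3 * (x - p) ^ 2 := by
  set c := -log p - log (1 - p) - 2 with hc
  set D : ℝ → ℝ := fun y => edgeRate y - c * (y - p) + 1 / 3 * (y - p) ^ 2 with hD
  have hcont : Continuous D := by
    have := continuous_edgeRate
    fun_prop
  have hderiv : ∀ y, 0 < y → y < 1 →
      HasDerivAt D (log (p * (1 - p) / (y * (1 - y))) + 2 / 3 * (y - p)) y := by
    intro y hy hy1
    have h1 := (hasDerivAt_edgeRate hy.ne' hy1.ne).sub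
      (((hasDerivAt_id y).sub_const p).const_mul c)
    have h2 := h1.add ((((hasDerivAt_id y).sub_const p).pow 2).const_mul (1 / 3))
    refine h2.congr_deriv ?_
    rw [log_div (by nlinarith) (by nlinarith), log_mul hp.ne' (by linarith),
      log_mul hy.ne' (by linarith), hc]
    simp only [id]
    ring
  have hDp : D p = edgeRate p := by simp [hD]
  suffices D x ≤ D p by
    rw [hDp] at this
    simp only [hD] at this
    linarith
  rcases le_total x p with hxp | hxp
  · refine monotoneOn_of_deriv_nonneg (convex_Icc 0 p) hcont.continuousOn ?_ ?_
      ⟨hx, hxp⟩ ⟨hp.le, le_rfl⟩ hxp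
    · rw [interior_Icc]
      intro y hy
      exact (hderiv y hy.1 (by linarith [hy.2])).differentiableAt.differentiableWithinAt
    · rw [interior_Icc]
      rintro y ⟨hy0, hyp⟩
      rw [(hderiv y hy0 (by linarith)).deriv]
      have hpp : 0 < p * (1 - p) := by nlinarith
      have hyy : 0 < y * (1 - y) := by nlinarith
      have h1 := one_sub_inv_le_log_of_pos (div_pos hpp hyy)
      rw [inv_div] at h1
      have h2 : 2 / 3 * (p - y) ≤ 1 - y * (1 - y) / (p * (1 - p)) := by
        rw [one_sub_div hpp.ne', le_div_iff₀ hpp]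
        have : p * (1 - p) ≤ 1 / 4 := by nlinarith [sq_nonneg (p - 1 / 2)]
        nlinarith [mul_nonneg (sub_nonneg.2 hyp.le) (sub_nonneg.2 this),
          mul_nonneg (sub_nonneg.2 hyp.le) (show 0 ≤ 1 - p - y - 1 / 6 by linarith)]
      linarith
  · refine antitoneOn_of_deriv_nonpos (convex_Icc p (1 / 2)) hcont.continuousOn ?_ ?_
      ⟨le_rfl, by linarith⟩ ⟨hxp, hx2⟩ hxp
    · rw [interior_Icc]
      intro y hy
      exact (hderiv y (by linarith [hy.1])
        (by linarith [hy.2])).differentiableAt.differentiableWithinAt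
    · rw [interior_Icc]
      rintro y ⟨hpy, hy2⟩
      rw [(hderiv y (by linarith) (by linarith)).deriv]
      have hpp : 0 < p * (1 - p) := by nlinarith
      have hyy : 0 < y * (1 - y) := by nlinarith
      have h1 := log_le_sub_one_of_pos (div_pos hpp hyy)
      have h2 : p * (1 - p) / (y * (1 - y)) - 1 ≤ -(2 / 3 * (y - p)) := by
        rw [div_sub_one hyy.ne', div_le_iff₀ hyy]
        have : y * (1 - y) ≤ 1 / 4 := by nlinarith [sq_nonneg (y - 1 / 2)]
        nlinarith [mul_nonneg (sub_nonneg.2 hpy.le) (sub_nonneg.2 this),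
          mul_nonneg (sub_nonneg.2 hpy.le) (show 0 ≤ 1 - p - y - 1 / 6 by linarith)]
      linarith

/-- The total rate when all but one coordinate share a mass `z` equally increases with `z`. -/
lemma strictMonoOn_edgeRate_profile {m : ℝ} (hm : 2 ≤ m) :
    StrictMonoOn (fun z => m * edgeRate (z / m) + edgeRate (1 - z)) (Set.Icc 0 (m / (m + 1))) := by
  have hm0 : 0 < m := by linarith
  refine strictMonoOn_of_deriv_pos (convex_Icc _ _) ?_ ?_
  · have := continuous_edgeRate
    exact Continuous.continuousOn (by fun_prop)
  · rw [interior_Icc]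
    rintro z ⟨hz0, hzm⟩
    have hz1 : z < 1 := hzm.trans (by rw [div_lt_one (by linarith)]; linarith)
    have hzm' : z / m < 1 := by rw [div_lt_one hm0]; linarith
    have hzm0 : 0 < z / m := div_pos hz0 hm0
    have h1 := ((hasDerivAt_edgeRate hzm0.ne' hzm'.ne).comp z
      ((hasDerivAt_id z).div_const m)).const_mul m
    have h2 := (hasDerivAt_edgeRate (x := 1 - z) (by linarith) (by linarith)).comp z
      ((hasDerivAt_id z).const_sub 1)
    have h3 : HasDerivAt (fun z => m * edgeRate (z / m) + edgeRate (1 - z)) _ z := h1.add h2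
    rw [h3.deriv]
    have h4 : log (z / m * (1 - z / m)) < log (z * (1 - z)) := by
      refine log_lt_log (mul_pos hzm0 (by linarith)) ?_
      rw [lt_div_iff₀ (by linarith)] at hzm
      rw [div_mul_eq_mul_div, div_lt_iff₀ hm0]
      have : 1 - z / m < (1 - z) * m := by
        rw [one_sub_div hm0.ne', div_lt_iff₀ hm0]
        nlinarith
      nlinarith
    rw [log_mul hzm0.ne' (by linarith), log_mul hz0.ne' (by linarith)] at h4
    rw [show 1 - (1 - z) = z by ring]
    have hcancel : ∀ y : ℝ, m * (y * (1 / m)) = y := fun y => by field_simp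
    rw [hcancel]
    linarith

/-- The total rate around a vertex is maximal, with a quadratic gap, at the uniform point. -/
lemma exists_sum_edgeRate_le (d : ℕ) (hd : 3 ≤ d) :
    ∃ c : ℝ, 0 < c ∧ ∀ {E : Type*} (s : Finset E) (x : E → ℝ), s.card = d →
      (∀ e ∈ s, 0 ≤ x e) → ∑ e ∈ s, x e = 1 →
      ∑ e ∈ s, edgeRate (x e) ≤
        d * edgeRate (1 / d) - c * ∑ e ∈ s, (x e - 1 / d) ^ 2 := by
  classical
  have hd' : (3 : ℝ) ≤ d := by exact_mod_cast hd
  have hd0 : (0 : ℝ) < d := by linarith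
  set m : ℝ := d - 1 with hm
  have hm2 : 2 ≤ m := by linarith
  set H : ℝ → ℝ := fun z => m * edgeRate (z / m) + edgeRate (1 - z) with hH
  have hmono := strictMonoOn_edgeRate_profile hm2
  have hhalf : (1 : ℝ) / 2 < m / (m + 1) := by
    rw [div_lt_div_iff₀ (by norm_num) (by linarith)]
    linarith
  have hgap : H (1 / 2) < H (m / (m + 1)) :=
    hmono ⟨by norm_num, hhalf.le⟩ ⟨by positivity, le_rfl⟩ hhalf
  have hHd : H (m / (m + 1)) = d * edgeRate (1 / d) := by
    simp only [hH]
    have hdm : (d : ℝ) = m + 1 := by rw [hm]; ring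
    have hm1 : m + 1 ≠ 0 := by linarith
    have hm0 : m ≠ 0 := by linarith
    rw [hdm, show m / (m + 1) / m = 1 / (m + 1) by field_simp,
      show 1 - m / (m + 1) = 1 / (m + 1) by field_simp; ring]
    ring
  set δ := H (m / (m + 1)) - H (1 / 2) with hδ
  have hδ0 : 0 < δ := sub_pos.2 hgap
  refine ⟨min (1 / 3) (δ / d), lt_min (by norm_num) (by positivity), ?_⟩
  intro E s x hcard hx hsum
  have hx1 : ∀ e ∈ s, x e ≤ 1 := fun e he => hsum ▸ Finset.single_le_sum hx he
  have hp : (0 : ℝ) < 1 / d := by positivity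
  have hp3 : (1 : ℝ) / d ≤ 1 / 3 := by gcongr
  have hsq : 0 ≤ ∑ e ∈ s, (x e - 1 / d) ^ 2 := Finset.sum_nonneg fun _ _ => sq_nonneg _
  by_cases hall : ∀ e ∈ s, x e ≤ 1 / 2
  · have h := Finset.sum_le_sum fun e he => edgeRate_le_tangent hp hp3 (hx e he) (hall e he)
    rw [Finset.sum_sub_distrib, Finset.sum_add_distrib, ← Finset.mul_sum, ← Finset.mul_sum,
      Finset.sum_sub_distrib, hsum, Finset.sum_const, Finset.sum_const, hcard, nsmul_eq_mul,
      nsmul_eq_mul, mul_one_div_cancel hd0.ne', sub_self, mul_zero, add_zero] at h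
    have := mul_le_mul_of_nonneg_right (min_le_left (1 / 3) (δ / d)) hsq
    linarith
  · push Not at hall
    obtain ⟨e₀, he₀, hbig⟩ := hall
    set z := 1 - x e₀ with hz
    have hz0 : 0 ≤ z := by linarith [hx1 e₀ he₀]
    have hz2 : z ≤ 1 / 2 := by linarith
    have hrest : ∑ e ∈ s.erase e₀, x e = z := by
      rw [hz, ← hsum, ← Finset.add_sum_erase s x he₀]
      ring
    have hcard' : ((s.erase e₀).card : ℝ) = m := by
      rw [Finset.card_erase_of_mem he₀, hcard, Nat.cast_sub (by lia), hm, Nat.cast_one]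
    have hle : ∑ e ∈ s.erase e₀, edgeRate (x e) ≤ m * edgeRate (z / m) := by
      have hxe : ∀ e ∈ s.erase e₀, 0 ≤ x e := fun e he => hx e (Finset.mem_of_mem_erase he)
      have hxz : ∀ e ∈ s.erase e₀, x e ≤ z := fun e he => hrest ▸ Finset.single_le_sum hxe he
      rcases hz0.eq_or_lt with h0 | h0
      · have : ∀ e ∈ s.erase e₀, edgeRate (x e) = 0 := fun e he => by
          rw [le_antisymm (h0 ▸ hxz e he) (hxe e he), edgeRate_zero]
        rw [Finset.sum_eq_zero this, ← h0, zero_div, edgeRate_zero, mul_zero]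
      · have hq : 0 < z / m := by positivity
        have hq3 : z / m ≤ 1 / 3 := by
          rw [div_le_iff₀ (by linarith)]
          linarith
        have h := Finset.sum_le_sum fun e he =>
          edgeRate_le_tangent hq hq3 (hxe e he) ((hxz e he).trans hz2)
        rw [Finset.sum_sub_distrib, Finset.sum_add_distrib, ← Finset.mul_sum, ← Finset.mul_sum,
          Finset.sum_sub_distrib, hrest, Finset.sum_const, Finset.sum_const, nsmul_eq_mul,
          nsmul_eq_mul, hcard', mul_div_cancel₀ _ (by linarith : m ≠ 0), sub_self, mul_zero,
          add_zero] at h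
        have : 0 ≤ ∑ e ∈ s.erase e₀, (x e - z / m) ^ 2 :=
          Finset.sum_nonneg fun _ _ => sq_nonneg _
        linarith
    have htot : ∑ e ∈ s, edgeRate (x e) ≤ H z := by
      rw [← Finset.add_sum_erase s _ he₀]
      simp only [hH]
      rw [show 1 - z = x e₀ by rw [hz]; ring]
      linarith
    have hHz : H z ≤ H (1 / 2) :=
      hmono.monotoneOn ⟨hz0, hz2.trans hhalf.le⟩ ⟨by norm_num, hhalf.le⟩ hz2
    have hsqle : ∑ e ∈ s, (x e - 1 / d) ^ 2 ≤ (d : ℝ) := by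
      have : ∀ e ∈ s, (x e - 1 / d) ^ 2 ≤ (1 : ℝ) := fun e he => by
        rw [sq_le_one_iff_abs_le_one, abs_le]
        constructor <;> linarith [hx e he, hx1 e he]
      refine (Finset.sum_le_sum this).trans ?_
      simp [hcard]
    have h1 := mul_le_mul_of_nonneg_right (min_le_right (1 / 3) (δ / d)) hsq
    have h2 : δ / d * ∑ e ∈ s, (x e - 1 / d) ^ 2 ≤ δ := by
      rw [div_mul_eq_mul_div, div_le_iff₀ hd0]
      exact mul_le_mul_of_nonneg_left hsqle hδ0.le
    linarith

/-- The factorial divided by its exponential growth `m log m - m`. -/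
noncomputable def factorialRatio (m : ℕ) : ℝ := (m ! : ℝ) / exp (m * log m - m)

lemma factorialRatio_pos (m : ℕ) : 0 < factorialRatio m := by
  unfold factorialRatio
  positivity

lemma factorial_eq_factorialRatio_mul (m : ℕ) :
    (m ! : ℝ) = factorialRatio m * exp (m * log m - m) := by
  rw [factorialRatio, div_mul_cancel₀ _ (exp_pos _).ne']

lemma tendsto_factorialRatio :
    Tendsto (fun m : ℕ => factorialRatio m / √(2 * π * m)) atTop (𝓝 1) := by
  have h := Stirling.tendsto_stirlingSeq_sqrt_pi.div_const (√π)
  rw [div_self (by positivity)] at h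
  refine h.congr' ?_
  filter_upwards [eventually_gt_atTop 0] with m hm
  have hm' : (0 : ℝ) < m := by exact_mod_cast hm
  have hexp : exp (m * log m - m) = (m / exp 1) ^ m := by
    rw [exp_sub, mul_comm, exp_mul, exp_log hm', rpow_natCast, div_pow, ← exp_nat_mul, mul_one]
  rw [Stirling.stirlingSeq, factorialRatio, hexp,
    show 2 * π * (m : ℝ) = (2 * m) * π by ring, sqrt_mul (by positivity) π]
  field_simp

/-- A positive sequence with a positive limit is bounded away from zero and infinity. -/
lemma exists_bounds_of_tendsto_pos {u : ℕ → ℝ} {l : ℝ} (hu : ∀ n, 0 < u n) (hl : 0 < l)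
    (h : Tendsto u atTop (𝓝 l)) : ∃ a b : ℝ, 0 < a ∧ 0 < b ∧ ∀ n, a ≤ u n ∧ u n ≤ b := by
  obtain ⟨b, hb⟩ := h.bddAbove_range
  obtain ⟨a, ha⟩ := (h.inv₀ hl.ne').bddAbove_range
  have hb' : ∀ n, u n ≤ b := fun n => hb ⟨n, rfl⟩
  have ha' : ∀ n, (u n)⁻¹ ≤ a := fun n => ha ⟨n, rfl⟩
  have ha0 : 0 < a := (inv_pos.2 (hu 0)).trans_le (ha' 0)
  exact ⟨a⁻¹, b, inv_pos.2 ha0, (hu 0).trans_le (hb' 0), fun n =>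
    ⟨inv_le_of_inv_le₀ (hu n) (ha' n), hb' n⟩⟩

lemma exists_factorialRatio_bounds :
    ∃ a b : ℝ, 0 < a ∧ 0 < b ∧
      ∀ m : ℕ, a * √(m + 1) ≤ factorialRatio m ∧ factorialRatio m ≤ b * √(m + 1) := by
  have h1 : Tendsto (fun m : ℕ => √(2 * π * m) / √((m : ℝ) + 1)) atTop (𝓝 √(2 * π)) := by
    have h := ((tendsto_natCast_div_add_atTop (1 : ℝ)).const_mul (2 * π)).sqrt
    rw [mul_one] at h
    refine h.congr fun m => ?_
    rw [← sqrt_div (by positivity), mul_div_assoc]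
  have h2 : Tendsto (fun m : ℕ => factorialRatio m / √((m : ℝ) + 1)) atTop (𝓝 √(2 * π)) := by
    have h := tendsto_factorialRatio.mul h1
    rw [one_mul] at h
    refine h.congr' ?_
    filter_upwards [eventually_gt_atTop 0] with m hm
    have hm' : (0 : ℝ) < m := by exact_mod_cast hm
    have : √(2 * π * m) ≠ 0 := by positivity
    field_simp
  obtain ⟨a, b, ha, hb, hab⟩ := exists_bounds_of_tendsto_pos
    (fun m => div_pos (factorialRatio_pos m) (by positivity)) (by positivity) h2
  refine ⟨a, b, ha, hb, fun m => ?_⟩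
  have h0 : 0 < √((m : ℝ) + 1) := by positivity
  exact ⟨(le_div_iff₀ h0).1 (hab m).1, (div_le_iff₀ h0).1 (hab m).2⟩

/-- The quotient of factorials on an edge in terms of its exponential rate. -/
lemma factorial_div_factorial_eq {n l : ℕ} (hn : 0 < n) (hl : l ≤ n) :
    ((n - l)! : ℝ) / (l ! : ℝ) =
      factorialRatio (n - l) / factorialRatio l * exp (n * edgeRate (l / n)) *
        exp ((n - 2 * l) * (log n - 1)) := by
  have hn' : (0 : ℝ) < n := by exact_mod_cast hn
  have hlog : ∀ y : ℝ, n * negMulLog (y / n) = y * log n - y * log y := fun y => by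
    rcases eq_or_ne y 0 with rfl | hy
    · simp
    · rw [negMulLog, log_div hy hn'.ne']
      field_simp
      ring
  rw [factorial_eq_factorialRatio_mul, factorial_eq_factorialRatio_mul l, mul_div_mul_comm,
    ← exp_sub, mul_assoc, ← exp_add]
  congr 2
  rw [edgeRate, mul_sub, one_sub_div hn'.ne', hlog, hlog, Nat.cast_sub hl]
  ring

/-- A polynomial loss is absorbed by a Gaussian weight away from the centre. -/
lemma exists_sqrt_div_le {p ε : ℝ} (hp : 0 < p) (hp1 : p ≤ 1) (hε : 0 < ε) :
    ∃ K : ℝ, 0 < K ∧ ∀ n l : ℕ, 0 < n →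
      √((n : ℝ) + 1) / √((l : ℝ) + 1) ≤ K * exp (ε * (n * ((l : ℝ) / n - p) ^ 2)) := by
  set a := min 1 (ε * (p / 2) ^ 2) with ha
  have ha0 : 0 < a := lt_min one_pos (by positivity)
  refine ⟨2 / p + a⁻¹, by positivity, fun n l hn => ?_⟩
  have hn' : (0 : ℝ) < n := by exact_mod_cast hn
  have hl0 : (0 : ℝ) ≤ l := by positivity
  have hexp : 1 ≤ exp (ε * (n * ((l : ℝ) / n - p) ^ 2)) := one_le_exp (by positivity)
  have hsqrt : √((n : ℝ) + 1) / √((l : ℝ) + 1) = √(((n : ℝ) + 1) / (l + 1)) := by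
    rw [sqrt_div (by positivity)]
  rw [hsqrt, add_mul]
  have hsq : ∀ y : ℝ, 1 ≤ y → √y ≤ y := fun y hy => by
    rw [sqrt_le_left (by linarith)]
    nlinarith
  rcases le_total (p / 2) ((l : ℝ) / n) with h | h
  · rw [le_div_iff₀ hn'] at h
    have h1 : ((n : ℝ) + 1) / (l + 1) ≤ 2 / p := by
      rw [div_le_div_iff₀ (by positivity) hp]
      nlinarith
    have h2 : √(((n : ℝ) + 1) / (l + 1)) ≤ 2 / p :=
      (sqrt_le_sqrt h1).trans (hsq _ (by rw [le_div_iff₀ hp]; linarith))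
    have h3 : 0 ≤ a⁻¹ * exp (ε * (n * ((l : ℝ) / n - p) ^ 2)) := by positivity
    have h4 : 2 / p ≤ 2 / p * exp (ε * (n * ((l : ℝ) / n - p) ^ 2)) :=
      le_mul_of_one_le_right (by positivity) hexp
    linarith
  · have h1 : √(((n : ℝ) + 1) / (l + 1)) ≤ n + 1 := by
      refine (sqrt_le_sqrt (div_le_self (by positivity) (by linarith))).trans (hsq _ (by linarith))
    have h2 : a * n ≤ ε * (n * ((l : ℝ) / n - p) ^ 2) := by
      have h5 : (p / 2) ^ 2 ≤ ((l : ℝ) / n - p) ^ 2 := by nlinarith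
      have h6 : a ≤ ε * ((l : ℝ) / n - p) ^ 2 :=
        (min_le_right _ _).trans (mul_le_mul_of_nonneg_left h5 hε.le)
      nlinarith
    have h3 : (n : ℝ) + 1 ≤ a⁻¹ * exp (ε * (n * ((l : ℝ) / n - p) ^ 2)) := by
      rw [← div_eq_inv_mul, le_div_iff₀ ha0]
      have := add_one_le_exp (ε * (n * ((l : ℝ) / n - p) ^ 2))
      have := min_le_left 1 (ε * (p / 2) ^ 2)
      nlinarith
    have h4 : 0 ≤ 2 / p * exp (ε * (n * ((l : ℝ) / n - p) ^ 2)) := by positivity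
    linarith

/-- Second order expansion of the rate. -/
lemma tendsto_edgeRate_taylor {p : ℝ} (hp : 0 < p) (hp1 : p < 1) :
    Tendsto (fun x => (edgeRate x - edgeRate p - (-log p - log (1 - p) - 2) * (x - p)) /
      (x - p) ^ 2) (𝓝[≠] p) (𝓝 ((1 / (1 - p) - 1 / p) / 2)) := by
  have hp1' : 1 - p ≠ 0 := by linarith
  set c := -log p - log (1 - p) - 2 with hc
  refine HasDerivAt.lhopital_zero_nhdsNE (f' := fun x => -log x - log (1 - x) - 2 - c)
    (g' := fun x => 2 * (x - p)) ?_ ?_ ?_ ?_ ?_ ?_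
  · refine eventually_nhdsWithin_of_eventually_nhds ?_
    filter_upwards [Ioo_mem_nhds hp hp1] with x hx
    have h := ((hasDerivAt_edgeRate hx.1.ne' hx.2.ne).sub_const (edgeRate p)).sub
      (((hasDerivAt_id x).sub_const p).const_mul c)
    refine h.congr_deriv ?_
    ring
  · refine Eventually.of_forall fun x => ?_
    refine (((hasDerivAt_id x).sub_const p).pow 2).congr_deriv ?_
    simp
  · filter_upwards [self_mem_nhdsWithin] with x hx
    exact mul_ne_zero two_ne_zero (sub_ne_zero.2 hx)
  · refine tendsto_nhdsWithin_of_tendsto_nhds (Continuous.tendsto' ?_ _ _ (by simp))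
    have := continuous_edgeRate
    fun_prop
  · exact tendsto_nhdsWithin_of_tendsto_nhds (Continuous.tendsto' (by fun_prop) _ _ (by simp))
  · have h1 : HasDerivAt (fun x => -log x - log (1 - x) - 2) (1 / (1 - p) - 1 / p) p := by
      have h := (((hasDerivAt_log hp.ne').neg).sub
        (((hasDerivAt_id p).const_sub 1).log hp1')).sub_const 2
      refine h.congr_deriv ?_
      simp only [id, one_div]
      ring
    have h2 := (hasDerivAt_iff_tendsto_slope.1 h1).div_const 2
    refine h2.congr fun x => ?_
    rw [slope_def_field, ← hc, div_div, mul_comm (x - p)]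

/-- Gaussian limit of the rate at the scale `√n`. -/
lemma tendsto_mul_edgeRate {p : ℝ} (hp : 0 < p) (hp1 : p < 1) (n : ℕ → ℝ)
    (hn : Tendsto n atTop atTop) (y : ℕ → ℝ) (s : ℝ)
    (hy : Tendsto (fun q => √(n q) * (y q - p)) atTop (𝓝 s)) :
    Tendsto (fun q => n q * (edgeRate (y q) - edgeRate p -
      (-log p - log (1 - p) - 2) * (y q - p))) atTop
      (𝓝 ((1 / (1 - p) - 1 / p) / 2 * s ^ 2)) := by
  have hyp : Tendsto y atTop (𝓝 p) := by
    have h := (hy.div_atTop (tendsto_sqrt_atTop.comp hn)).add_const p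
    rw [zero_add] at h
    refine h.congr' ?_
    filter_upwards [hn.eventually_gt_atTop 0] with q hq
    have : √(n q) ≠ 0 := (sqrt_pos.2 hq).ne'
    simp only [Function.comp_apply]
    field_simp
    ring
  set D : ℝ → ℝ := fun x => edgeRate x - edgeRate p - (-log p - log (1 - p) - 2) * (x - p) with hD
  have hcont := continuousAt_update_same.2 (tendsto_edgeRate_taylor hp hp1)
  have h1 := hcont.tendsto.comp hyp
  rw [Function.update_self] at h1
  refine (h1.mul (hy.pow 2)).congr' ?_
  filter_upwards [hn.eventually_gt_atTop 0] with q hq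
  simp only [Function.comp_apply]
  rcases eq_or_ne (y q) p with h | h
  · simp [h]
  · have h2 : y q - p ≠ 0 := sub_ne_zero.2 h
    rw [Function.update_of_ne h, mul_pow, sq_sqrt hq.le]
    field_simp

/-- The summand attached to an edge vector, divided by its value at the uniform point. -/
noncomputable def normalizedTerm {E : Type*} [Fintype E] (d : ℕ) (z : ℤ) (n : ℕ) (l : E → ℕ) : ℝ :=
  (factorialRatio n / √(2 * π * n)) ^ z *
    (∏ e, factorialRatio (n - l e) / factorialRatio (l e) / √((d : ℝ) - 1)) *
    exp (n * ∑ e, (edgeRate (l e / n) - edgeRate (1 / d)))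

/-- The summand at the uniform point, to leading order. -/
noncomputable def centralTerm (d : ℕ) (z : ℤ) (h n : ℕ) : ℝ :=
  √(2 * π * n) ^ z * √((d : ℝ) - 1) ^ h * exp (h * n * edgeRate (1 / d))

lemma factorial_zpow_mul_prod_eq {E : Type*} [Fintype E] {d g n : ℕ} (hd : 3 ≤ d) (hn : 0 < n)
    (l : E → ℕ) (hl : ∀ e, l e ≤ n) (hsum : 2 * ∑ e, (l e : ℝ) = g * n) :
    (n ! : ℝ) ^ ((g : ℤ) - (Fintype.card E : ℤ)) * ∏ e, ((n - l e)! : ℝ) / ((l e)! : ℝ) =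
      centralTerm d ((g : ℤ) - (Fintype.card E : ℤ)) (Fintype.card E) n *
        normalizedTerm d ((g : ℤ) - (Fintype.card E : ℤ)) n l := by
  have hd' : (3 : ℝ) ≤ d := by exact_mod_cast hd
  have hn' : (0 : ℝ) < n := by exact_mod_cast hn
  set h := Fintype.card E with hh
  set z : ℤ := (g : ℤ) - (h : ℤ) with hz
  have hs1 : √(2 * π * n) ≠ 0 := by positivity
  have hs2 : √((d : ℝ) - 1) ≠ 0 := (sqrt_pos.2 (by linarith)).ne'
  have hez : exp (n * log n - n) ^ z = exp (z * (n * log n - n)) := by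
    rw [← rpow_intCast, ← exp_mul, mul_comm]
  simp_rw [fun e => factorial_div_factorial_eq hn (hl e)]
  rw [Finset.prod_mul_distrib, Finset.prod_mul_distrib, ← exp_sum, ← exp_sum, ← Finset.sum_mul,
    Finset.sum_sub_distrib, ← Finset.mul_sum, ← Finset.mul_sum, hsum,
    factorial_eq_factorialRatio_mul n, mul_zpow, centralTerm, normalizedTerm, div_zpow,
    Finset.prod_div_distrib (f := fun e => factorialRatio (n - l e) / factorialRatio (l e)),
    Finset.prod_const, Finset.sum_sub_distrib, Finset.sum_const, Finset.sum_const,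
    Finset.card_univ, ← hh, nsmul_eq_mul, nsmul_eq_mul, hez, mul_sub (n : ℝ) (∑ e, _),
    exp_sub (n * ∑ e, _)]
  have hcancel : exp ((z : ℝ) * (n * log n - n)) * exp ((h * n - g * n) * (log n - 1)) = 1 := by
    rw [← exp_add, exp_eq_one_iff, hz]
    push_cast
    ring
  have hexp : exp (n * (h * edgeRate (1 / d))) = exp (h * n * edgeRate (1 / d)) := by
    congr 1; ring
  rw [hexp]
  have hz1 : √(2 * π * n) ^ z ≠ 0 := zpow_ne_zero _ hs1
  have hpos := (exp_pos (h * n * edgeRate (1 / d))).ne'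
  generalize exp (h * n * edgeRate (1 / d)) = X at *
  generalize exp (n * ∑ e, edgeRate (l e / n)) = Y
  generalize exp ((z : ℝ) * (n * log n - n)) = Z at *
  generalize exp ((h * n - g * n) * (log n - 1)) = U at *
  field_simp
  linear_combination (factorialRatio n ^ z *
    (∏ e, factorialRatio (n - l e) / factorialRatio (l e)) * Y) * hcancel

/-- Gaussian limit of the normalized summand at the scale `√n`. -/
lemma tendsto_normalizedTerm {E : Type*} [Fintype E] {d : ℕ} (hd : 3 ≤ d) (z : ℤ)
    (l : ℕ → E → ℕ) (s : E → ℝ) (hl : ∀ᶠ q in atTop, ∀ e, l q e ≤ d * q)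
    (hsum : ∀ᶠ q in atTop, ∑ e, ((l q e : ℝ) - q) = 0)
    (hs : ∀ e, Tendsto (fun q : ℕ => ((l q e : ℝ) - q) / √((d * q : ℕ) : ℝ)) atTop (𝓝 (s e))) :
    Tendsto (fun q => normalizedTerm d z (d * q) (l q)) atTop
      (𝓝 (exp (-((d : ℝ) * (d - 2) / (2 * (d - 1))) * ∑ e, s e ^ 2))) := by
  have hd' : (3 : ℝ) ≤ d := by exact_mod_cast hd
  have hd0 : (0 : ℝ) < d := by linarith
  have hnN : Tendsto (fun q : ℕ => d * q) atTop atTop :=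
    tendsto_id.const_mul_atTop' (by lia)
  have hn : Tendsto (fun q : ℕ => ((d * q : ℕ) : ℝ)) atTop atTop :=
    tendsto_natCast_atTop_atTop.comp hnN
  have hp : (0 : ℝ) < 1 / d := by positivity
  have hp1 : (1 : ℝ) / d < 1 := by rw [div_lt_one hd0]; linarith
  have hs' : ∀ e, Tendsto (fun q : ℕ => √((d * q : ℕ) : ℝ) *
      ((l q e : ℝ) / (d * q : ℕ) - 1 / d)) atTop (𝓝 (s e)) := fun e => by
    refine (hs e).congr' ?_
    filter_upwards [eventually_gt_atTop 0] with q hq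
    have hq' : (0 : ℝ) < q := by exact_mod_cast hq
    have h1 : (0 : ℝ) < ((d * q : ℕ) : ℝ) := by push_cast; positivity
    have h2 := mul_self_sqrt h1.le
    have h3 : √((d * q : ℕ) : ℝ) ≠ 0 := (sqrt_pos.2 h1).ne'
    have h4 : ((l q e : ℝ) / (d * q : ℕ) - 1 / d) = ((l q e : ℝ) - q) / (d * q : ℕ) := by
      push_cast
      field_simp
    rw [h4, div_eq_iff h3, mul_comm, ← mul_assoc, h2, mul_div_cancel₀ _ h1.ne']
  have hfrac : ∀ e, Tendsto (fun q : ℕ => (l q e : ℝ) / (d * q : ℕ)) atTop (𝓝 (1 / d)) :=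
    fun e => by
    have h := ((hs' e).div_atTop (tendsto_sqrt_atTop.comp hn)).add_const (1 / (d : ℝ))
    rw [zero_add] at h
    refine h.congr' ?_
    filter_upwards [hn.eventually_gt_atTop 0] with q hq
    have : √((d * q : ℕ) : ℝ) ≠ 0 := (sqrt_pos.2 hq).ne'
    simp only [Function.comp_apply]
    rw [mul_div_cancel_left₀ _ this]
    ring
  have hfirst : Tendsto (fun q : ℕ => (factorialRatio (d * q) / √(2 * π * (d * q : ℕ))) ^ z)
      atTop (𝓝 1) := by
    have h := (tendsto_factorialRatio.comp hnN).zpow₀ z (Or.inl one_ne_zero)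
    rwa [one_zpow] at h
  have hprod : Tendsto (fun q : ℕ => ∏ e, factorialRatio (d * q - l q e) / factorialRatio (l q e) /
      √((d : ℝ) - 1)) atTop (𝓝 1) := by
    suffices h : ∀ e, Tendsto (fun q : ℕ => factorialRatio (d * q - l q e) /
        factorialRatio (l q e) / √((d : ℝ) - 1)) atTop (𝓝 1) by
      simpa only [Finset.prod_const_one] using
        tendsto_finsetProd Finset.univ fun e _ => h e
    intro e
    have hl1 : Tendsto (fun q => l q e) atTop atTop := by
      rw [← tendsto_natCast_atTop_iff (R := ℝ)]
      refine ((hfrac e).pos_mul_atTop hp hn).congr' ?_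
      filter_upwards [hn.eventually_gt_atTop 0] with q hq
      rw [div_mul_cancel₀ _ hq.ne']
    have hfrac2 : Tendsto (fun q : ℕ => ((d * q - l q e : ℕ) : ℝ) / (d * q : ℕ)) atTop
        (𝓝 (1 - 1 / d)) := by
      refine ((hfrac e).const_sub 1).congr' ?_
      filter_upwards [hl, hn.eventually_gt_atTop 0] with q hq hq0
      rw [Nat.cast_sub (hq e), sub_div, div_self hq0.ne']
    have hl2 : Tendsto (fun q => d * q - l q e) atTop atTop := by
      rw [← tendsto_natCast_atTop_iff (R := ℝ)]
      refine (hfrac2.pos_mul_atTop (by linarith) hn).congr' ?_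
      filter_upwards [hn.eventually_gt_atTop 0] with q hq
      rw [div_mul_cancel₀ _ hq.ne']
    have h1 := (tendsto_factorialRatio.comp hl2).div (tendsto_factorialRatio.comp hl1) one_ne_zero
    have h2 := ((hfrac2.div (hfrac e) hp.ne').sqrt).div_const √((d : ℝ) - 1)
    have h3 := h1.mul h2
    have hval : (1 : ℝ) / 1 * (√((1 - 1 / (d : ℝ)) / (1 / d)) / √((d : ℝ) - 1)) = 1 := by
      rw [show (1 - 1 / (d : ℝ)) / (1 / d) = d - 1 by field_simp,
        div_self (sqrt_pos.2 (by linarith)).ne']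
      norm_num
    rw [hval] at h3
    refine h3.congr' ?_
    filter_upwards [hn.eventually_gt_atTop 0, hl1.eventually_gt_atTop 0,
      hl2.eventually_gt_atTop 0] with q hq h1q h2q
    have h1' : (0 : ℝ) < l q e := by exact_mod_cast h1q
    have h2' : (0 : ℝ) < (d * q - l q e : ℕ) := by exact_mod_cast h2q
    simp only [Function.comp_apply, Pi.div_apply]
    rw [div_div_div_cancel_right₀ hq.ne', sqrt_div h2'.le,
      sqrt_mul (x := 2 * π) (by positivity) ((d * q - l q e : ℕ) : ℝ),
      sqrt_mul (x := 2 * π) (by positivity) (l q e : ℝ)]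
    have e1 : √(2 * π) ≠ 0 := by positivity
    have e2 : √((d * q - l q e : ℕ) : ℝ) ≠ 0 := (sqrt_pos.2 h2').ne'
    have e3 : √(l q e : ℝ) ≠ 0 := (sqrt_pos.2 h1').ne'
    have e4 := (factorialRatio_pos (l q e)).ne'
    field_simp
  have hexp : Tendsto (fun q : ℕ => exp ((d * q : ℕ) *
      ∑ e, (edgeRate (l q e / (d * q : ℕ)) - edgeRate (1 / d)))) atTop
      (𝓝 (exp (-((d : ℝ) * (d - 2) / (2 * (d - 1))) * ∑ e, s e ^ 2))) := by
    refine (continuous_exp.tendsto _).comp ?_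
    have h := tendsto_finsetSum Finset.univ fun e _ => tendsto_mul_edgeRate hp hp1 _ hn _ _ (hs' e)
    rw [← Finset.mul_sum, show (1 / (1 - 1 / (d : ℝ)) - 1 / (1 / d)) / 2 =
      -((d : ℝ) * (d - 2) / (2 * (d - 1))) by
        have : (d : ℝ) - 1 ≠ 0 := by linarith
        field_simp
        ring] at h
    refine h.congr' ?_
    filter_upwards [hsum, hn.eventually_gt_atTop 0] with q hq hq0
    have hzero : ∑ e, ((l q e : ℝ) / (d * q : ℕ) - 1 / d) = 0 := by
      have : ∀ e, ((l q e : ℝ) / (d * q : ℕ) - 1 / d) = ((l q e : ℝ) - q) / (d * q : ℕ) :=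
        fun e => by
        have hq' : (q : ℝ) ≠ 0 := by
          rintro h0
          rw [Nat.cast_mul, h0, mul_zero] at hq0
          exact lt_irrefl _ hq0
        push_cast
        field_simp
      rw [Finset.sum_congr rfl fun e _ => this e, ← Finset.sum_div, hq, zero_div]
    rw [← Finset.mul_sum, Finset.sum_sub_distrib _ fun e => _ * ((l q e : ℝ) / (d * q : ℕ) - 1 / d),
      ← Finset.mul_sum, hzero, mul_zero, sub_zero]
  have := (hfirst.mul hprod).mul hexp
  simpa only [one_mul, normalizedTerm] using this

/-- Gaussian bound for the normalized summand, uniform over all admissible edge vectors. -/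
lemma exists_normalizedTerm_le {V : Type*} [Fintype V] [DecidableEq V] (G : SimpleGraph V)
    [DecidableRel G.Adj] {d : ℕ} (hd : 3 ≤ d) (hreg : G.IsRegularOfDegree d)
    (hcard : 2 * Fintype.card G.edgeSet = d * Fintype.card V) (z : ℤ) :
    ∃ K c : ℝ, 0 < c ∧ ∀ (n : ℕ) (l : G.edgeSet → ℕ), 0 < n → (∀ e, l e ≤ n) →
      (∀ v, ∑ e : G.edgeSet, (if v ∈ (e : Sym2 V) then l e else 0) = n) →
      |normalizedTerm d z n l| ≤ K * exp (-c * ∑ e, n * ((l e : ℝ) / n - 1 / d) ^ 2) := by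
  have hd' : (3 : ℝ) ≤ d := by exact_mod_cast hd
  have hd0 : (0 : ℝ) < d := by linarith
  obtain ⟨c, hc, hrate⟩ := exists_sum_edgeRate_le d hd
  obtain ⟨a, b, ha, hb, hab⟩ := exists_factorialRatio_bounds
  obtain ⟨K, hK, hsqrt⟩ := exists_sqrt_div_le (p := 1 / d) (ε := c / 2) (by positivity)
    (by rw [div_le_one hd0]; linarith) (by positivity)
  obtain ⟨A, hA⟩ := (tendsto_factorialRatio.zpow₀ z (Or.inl one_ne_zero)).bddAbove_range
  have hA' : ∀ n : ℕ, (factorialRatio n / √(2 * π * n)) ^ z ≤ A := fun n => hA ⟨n, rfl⟩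
  refine ⟨A * (b / a * K) ^ Fintype.card G.edgeSet, c / 2, by positivity, ?_⟩
  intro n l hn hl hv
  have hn' : (0 : ℝ) < n := by exact_mod_cast hn
  set Y : G.edgeSet → ℝ := fun e => n * ((l e : ℝ) / n - 1 / d) ^ 2 with hY
  have hpos1 : 0 ≤ (factorialRatio n / √(2 * π * n)) ^ z :=
    zpow_nonneg (div_nonneg (factorialRatio_pos n).le (sqrt_nonneg _)) _
  have hfac : ∀ e, 0 ≤ factorialRatio (n - l e) / factorialRatio (l e) / √((d : ℝ) - 1) :=
    fun e => div_nonneg (div_nonneg (factorialRatio_pos _).le (factorialRatio_pos _).le)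
      (sqrt_nonneg _)
  have hedge : ∀ e, factorialRatio (n - l e) / factorialRatio (l e) / √((d : ℝ) - 1) ≤
      b / a * K * exp (c / 2 * Y e) := fun e => by
    have h1 : 1 ≤ √((d : ℝ) - 1) := by rw [one_le_sqrt]; linarith
    refine (div_le_self (div_nonneg (factorialRatio_pos _).le (factorialRatio_pos _).le) h1).trans ?_
    have hs0 : 0 < √((l e : ℝ) + 1) := by positivity
    have h2 : factorialRatio (n - l e) ≤ b * √((n : ℝ) + 1) :=
      (hab _).2.trans (mul_le_mul_of_nonneg_left (sqrt_le_sqrt (by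
        have : ((n - l e : ℕ) : ℝ) ≤ n := by exact_mod_cast Nat.sub_le _ _
        linarith)) hb.le)
    have h3 := hsqrt n (l e) hn
    calc factorialRatio (n - l e) / factorialRatio (l e)
        ≤ b * √((n : ℝ) + 1) / (a * √((l e : ℝ) + 1)) :=
          div_le_div₀ (by positivity) h2 (by positivity) (hab _).1
      _ = b / a * (√((n : ℝ) + 1) / √((l e : ℝ) + 1)) := by rw [mul_div_mul_comm]
      _ ≤ b / a * (K * exp (c / 2 * Y e)) := mul_le_mul_of_nonneg_left h3 (by positivity)
      _ = _ := by ring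
  have hprod := Finset.prod_le_prod (s := Finset.univ) (fun e _ => hfac e) fun e _ => hedge e
  rw [Finset.prod_mul_distrib, Finset.prod_const, Finset.card_univ, ← exp_sum,
    ← Finset.mul_sum] at hprod
  have hvertex : ∀ v, ∑ e : G.edgeSet, (if v ∈ (e : Sym2 V) then edgeRate (l e / n) else 0) ≤
      d * edgeRate (1 / d) -
        c * ∑ e : G.edgeSet, (if v ∈ (e : Sym2 V) then ((l e : ℝ) / n - 1 / d) ^ 2 else 0) :=
    fun v => by
    rw [← Finset.sum_filter, ← Finset.sum_filter]
    refine hrate _ (fun e : G.edgeSet => (l e : ℝ) / n) ?_ (fun e _ => by positivity) ?_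
    · rw [card_filter_mem_edge, hreg.degree_eq]
    · rw [← Finset.sum_div, div_eq_one_iff_eq hn'.ne', Finset.sum_filter]
      have := hv v
      exact_mod_cast this
  have htotal := Finset.sum_le_sum fun v (_ : v ∈ Finset.univ) => hvertex v
  rw [sum_sum_ite_mem_edge, Finset.sum_sub_distrib, Finset.sum_const, ← Finset.mul_sum,
    sum_sum_ite_mem_edge, Finset.card_univ, nsmul_eq_mul] at htotal
  have hcard' : 2 * (Fintype.card G.edgeSet : ℝ) = d * Fintype.card V := by exact_mod_cast hcard
  have hexp : n * ∑ e, (edgeRate (l e / n) - edgeRate (1 / d)) ≤ -c * ∑ e, Y e := by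
    simp only [hY]
    rw [← Finset.mul_sum, Finset.sum_sub_distrib, Finset.sum_const, Finset.card_univ, nsmul_eq_mul]
    have : ∑ e : G.edgeSet, edgeRate (l e / n) - Fintype.card G.edgeSet * edgeRate (1 / d) ≤
        -c * ∑ e : G.edgeSet, ((l e : ℝ) / n - 1 / d) ^ 2 := by
      linear_combination (1 / 2) * htotal - (1 / 2) * edgeRate (1 / d) * hcard'
    calc _ ≤ n * (-c * ∑ e : G.edgeSet, ((l e : ℝ) / n - 1 / d) ^ 2) :=
          mul_le_mul_of_nonneg_left this hn'.le
      _ = _ := by ring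
  rw [normalizedTerm, abs_of_nonneg (mul_nonneg (mul_nonneg hpos1
    (Finset.prod_nonneg fun e _ => hfac e)) (exp_pos _).le)]
  have hA0 : 0 ≤ A := hpos1.trans (hA' n)
  calc _ ≤ A * ((b / a * K) ^ Fintype.card G.edgeSet * exp (c / 2 * ∑ e, Y e)) *
        exp (-c * ∑ e, Y e) := by
        gcongr
        · exact Finset.prod_nonneg fun e _ => hfac e
        · exact hA' n
    _ = _ := by
        rw [mul_assoc, mul_assoc, ← exp_add, mul_assoc]
        congr 3
        ring

/-- The summand at the uniform point times the Gaussian volume, in closed form. -/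
lemma centralTerm_mul_gaussian_eq {d g h r n : ℕ} (hd : 3 ≤ d) (hn : 0 < n) (hdg : 2 * h = d * g)
    (hr : r + g = h + 1) (D : ℝ) :
    centralTerm d ((g : ℤ) - (h : ℤ)) h n * √(n : ℝ) ^ r *
      (√(π / ((d : ℝ) * (d - 2) / (2 * (d - 1)))) ^ r / √D) =
    ((d : ℝ) - 1) ^ (((d : ℝ) - 1) * g / 2 + 1 / 2) /
      (((d : ℝ) * ((d : ℝ) - 2)) ^ ((d : ℝ) * g / 4 - (g : ℝ) / 2 + 1 / 2) * √D) *
      √(2 * π * n) * ((((d : ℝ) - 1) ^ (d - 1) / (d : ℝ) ^ (d - 2)) ^ ((g : ℝ) * n / 2)) := by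
  have hd' : (3 : ℝ) ≤ d := by exact_mod_cast hd
  have hd0 : (0 : ℝ) < d := by linarith
  have hd1 : (0 : ℝ) < d - 1 := by linarith
  have hd2 : (0 : ℝ) < d - 2 := by linarith
  have hn' : (0 : ℝ) < n := by exact_mod_cast hn
  have hdg' : 2 * (h : ℝ) = d * g := by exact_mod_cast hdg
  have hr' : (r : ℝ) + g = h + 1 := by exact_mod_cast hr
  have hpow : ∀ (x : ℝ) (k : ℕ), 0 < x → √x ^ k = x ^ ((k : ℝ) / 2) := fun x k hx => by
    rw [sqrt_eq_rpow, ← rpow_natCast, ← rpow_mul hx.le]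
    congr 1
    ring
  have h1 : √(n : ℝ) * √(π / ((d : ℝ) * (d - 2) / (2 * (d - 1)))) =
      √(2 * π * n) * √((d : ℝ) - 1) / √((d : ℝ) * (d - 2)) := by
    rw [← sqrt_mul hn'.le, ← sqrt_mul (by positivity), ← sqrt_div (by positivity)]
    congr 1
    field_simp
  have h2 : √(2 * π * n) ^ ((g : ℤ) - (h : ℤ)) * √(2 * π * n) ^ r = √(2 * π * n) := by
    rw [← zpow_natCast, ← zpow_add₀ (by positivity), show (g : ℤ) - h + r = 1 by lia, zpow_one]
  have h3 : √((d : ℝ) - 1) ^ h * √((d : ℝ) - 1) ^ r =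
      ((d : ℝ) - 1) ^ (((d : ℝ) - 1) * g / 2 + 1 / 2) := by
    rw [← pow_add, hpow _ _ hd1]
    congr 1
    push_cast
    linear_combination (1 / 2) * hdg' + (1 / 2) * hr'
  have h4 : √((d : ℝ) * (d - 2)) ^ r =
      ((d : ℝ) * ((d : ℝ) - 2)) ^ ((d : ℝ) * g / 4 - (g : ℝ) / 2 + 1 / 2) := by
    rw [hpow _ _ (by positivity)]
    congr 1
    linear_combination (1 / 4) * hdg' + (1 / 2) * hr'
  have h5 : exp (h * n * edgeRate (1 / d)) =
      ((((d : ℝ) - 1) ^ (d - 1) / (d : ℝ) ^ (d - 2)) ^ ((g : ℝ) * n / 2)) := by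
    rw [rpow_def_of_pos (by positivity), log_div (by positivity) (by positivity), log_pow, log_pow,
      Nat.cast_sub (by lia), Nat.cast_sub (by lia), edgeRate, negMulLog, negMulLog,
      show 1 - 1 / (d : ℝ) = (d - 1) / d by field_simp, log_div hd1.ne' hd0.ne', one_div, log_inv]
    congr 1
    have : (h : ℝ) = d * g / 2 := by linarith
    rw [this]
    push_cast
    field_simp
    ring
  have h6 : √(n : ℝ) ^ r * √(π / ((d : ℝ) * (d - 2) / (2 * (d - 1)))) ^ r =
      √(2 * π * n) ^ r * √((d : ℝ) - 1) ^ r / √((d : ℝ) * (d - 2)) ^ r := by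
    rw [← mul_pow, h1, div_pow, mul_pow]
  rw [centralTerm, ← h3, ← h4, ← h5]
  generalize √(n : ℝ) ^ r = X at *
  generalize √(π / ((d : ℝ) * (d - 2) / (2 * (d - 1)))) ^ r = Y at *
  generalize √(2 * π * n) ^ r = Z at *
  generalize √(2 * π * n) ^ ((g : ℤ) - (h : ℤ)) = W at *
  generalize √((d : ℝ) * (d - 2)) ^ r = U at *
  linear_combination (W * √((d : ℝ) - 1) ^ h * exp (h * n * edgeRate (1 / d)) / √D) * h6 +
    (√((d : ℝ) - 1) ^ h * √((d : ℝ) - 1) ^ r * exp (h * n * edgeRate (1 / d)) / (U * √D)) * h2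

lemma isEquivalent_inf_principal_dvd {d : ℕ} (hd : 0 < d) {u v : ℕ → ℝ}
    (hv : ∀ n, 0 < n → v n ≠ 0) (h : Tendsto (fun q => u (d * q) / v (d * q)) atTop (𝓝 1)) :
    Asymptotics.IsEquivalent (atTop ⊓ 𝓟 {n : ℕ | d ∣ n}) u v := by
  have hle : atTop ⊓ 𝓟 {n : ℕ | d ∣ n} ≤ map (fun q => d * q) atTop := by
    intro s hs
    obtain ⟨Q, hQ⟩ := mem_atTop_sets.1 (mem_map.1 hs)
    rw [mem_inf_principal]
    filter_upwards [eventually_ge_atTop (d * Q)] with n hn hdn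
    obtain ⟨k, rfl⟩ := hdn
    exact hQ k (Nat.le_of_mul_le_mul_left hn hd)
  rw [Asymptotics.isEquivalent_iff_tendsto_one]
  · exact (tendsto_map'_iff.2 h).mono_left hle
  · exact ((eventually_gt_atTop 0).filter_mono inf_le_left).mono hv

end

section

open Filter Topology Real
open scoped Nat Matrix

/-- Edge vectors with values in `{0, …, n}` and sum `n` around every vertex. -/
def admissibleVectors {V : Type*} [Fintype V] [DecidableEq V] (G : SimpleGraph V)
    [DecidableRel G.Adj] (n : ℕ) : Finset (G.edgeSet → Fin (n + 1)) :=
  Finset.univ.filter fun l => ∀ v : V, ∑ e : G.edgeSet, (if v ∈ (e : Sym2 V) then (l e).val else 0) = n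

section lattice

variable {V : Type*} [Fintype V] [DecidableEq V] (G : SimpleGraph V) [DecidableRel G.Adj]

lemma sum_ite_mem_const {R : Type*} [CommRing R] {d : ℕ} (hreg : G.IsRegularOfDegree d) (v : V)
    (q : R) : ∑ e : G.edgeSet, (if v ∈ (e : Sym2 V) then q else 0) = d * q := by
  rw [← Finset.sum_filter, Finset.sum_const, card_filter_mem_edge, hreg.degree_eq, nsmul_eq_mul]

lemma mulVec_mulVec_eq_of_mem_admissibleVectors {d q r : ℕ} (hreg : G.IsRegularOfDegree d)
    {v₀ : V} {N : Matrix G.edgeSet (Fin r) ℤ} {M : Matrix (Fin r) G.edgeSet ℤ}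
    {C : Matrix G.edgeSet {w // w ≠ v₀} ℤ} (hsum : N * M + C * reducedIncMatrix G v₀ = 1)
    {l : G.edgeSet → Fin (d * q + 1)} (hl : l ∈ admissibleVectors G (d * q)) :
    N *ᵥ (M *ᵥ fun e => ((l e : ℕ) : ℤ) - q) = fun e => ((l e : ℕ) : ℤ) - q := by
  set x : G.edgeSet → ℤ := fun e => ((l e : ℕ) : ℤ) - q with hx
  have hB : reducedIncMatrix G v₀ *ᵥ x = 0 := by
    funext v
    have h1 := (Finset.mem_filter.1 hl).2 v.1
    have h2 : ∑ e : G.edgeSet, (if v.1 ∈ (e : Sym2 V) then ((l e : ℕ) : ℤ) else 0) = d * q := by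
      exact_mod_cast h1
    have h3 := sub_eq_zero.2 (h2.trans (sum_ite_mem_const G hreg v.1 (q : ℤ)).symm)
    rw [← Finset.sum_sub_distrib] at h3
    rw [reducedIncMatrix_mulVec, Pi.zero_apply]
    refine Eq.trans (Finset.sum_congr rfl fun e _ => ?_) h3
    split_ifs <;> simp [hx]
  have h := congrArg (· *ᵥ x) hsum
  simpa only [Matrix.add_mulVec, ← Matrix.mulVec_mulVec, hB, Matrix.mulVec_zero, add_zero,
    Matrix.one_mulVec] using h

lemma sum_ite_mem_mulVec_eq_zero {r : ℕ} (hbip : G.Colorable 2) {v₀ : V}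
    {N : Matrix G.edgeSet (Fin r) ℤ} (hBN : reducedIncMatrix G v₀ * N = 0) (t : Fin r → ℤ) (v : V) :
    ∑ e : G.edgeSet, (if v ∈ (e : Sym2 V) then (N *ᵥ t) e else 0) = 0 := by
  refine sum_ite_mem_eq_zero_of_colorable G hbip v₀ _ (fun w hw => ?_) v
  rw [← reducedIncMatrix_mulVec G v₀ (N *ᵥ t) ⟨w, hw⟩, Matrix.mulVec_mulVec, hBN,
    Matrix.zero_mulVec, Pi.zero_apply]

lemma sum_mulVec_eq_zero {r : ℕ} (hbip : G.Colorable 2) {v₀ : V}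
    {N : Matrix G.edgeSet (Fin r) ℤ} (hBN : reducedIncMatrix G v₀ * N = 0) (t : Fin r → ℤ) :
    ∑ e, (N *ᵥ t) e = 0 := by
  have h := sum_sum_ite_mem_edge G (N *ᵥ t)
  rw [Finset.sum_eq_zero fun v _ => sum_ite_mem_mulVec_eq_zero G hbip hBN t v] at h
  lia

lemma sum_ite_mem_toNat_eq {d q r : ℕ} (hreg : G.IsRegularOfDegree d) (hbip : G.Colorable 2)
    {v₀ : V} {N : Matrix G.edgeSet (Fin r) ℤ} (hBN : reducedIncMatrix G v₀ * N = 0)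
    {t : Fin r → ℤ} (ht : ∀ e, 0 ≤ (q : ℤ) + (N *ᵥ t) e) (v : V) :
    ∑ e : G.edgeSet, (if v ∈ (e : Sym2 V) then ((q : ℤ) + (N *ᵥ t) e).toNat else 0) = d * q := by
  have h := congrArg₂ (· + ·) (sum_ite_mem_const G hreg v (q : ℤ))
    (sum_ite_mem_mulVec_eq_zero G hbip hBN t v)
  simp only [← Finset.sum_add_distrib, add_zero] at h
  zify
  rw [← h]
  refine Finset.sum_congr rfl fun e _ => ?_
  split_ifs
  · rw [Int.toNat_of_nonneg (ht e)]
  · simp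

/-- Sums over admissible vectors, rewritten in the coordinates of the cycle lattice. -/
lemma exists_sum_admissibleVectors_eq {d r : ℕ} (hreg : G.IsRegularOfDegree d)
    (hbip : G.Colorable 2) {v₀ : V} {N : Matrix G.edgeSet (Fin r) ℤ}
    {M : Matrix (Fin r) G.edgeSet ℤ} {C : Matrix G.edgeSet {w // w ≠ v₀} ℤ} (hMN : M * N = 1)
    (hBN : reducedIncMatrix G v₀ * N = 0) (hsum : N * M + C * reducedIncMatrix G v₀ = 1) (q : ℕ)
    (F : (G.edgeSet → ℕ) → ℝ) (W : (Fin r → ℤ) → ℝ)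
    (hW : ∀ t, (∀ e, 0 ≤ (q : ℤ) + (N *ᵥ t) e ∧ (q : ℤ) + (N *ᵥ t) e ≤ (d * q : ℕ)) →
      W t = F fun e => ((q : ℤ) + (N *ᵥ t) e).toNat)
    (hW0 : ∀ t, (¬ ∀ e, 0 ≤ (q : ℤ) + (N *ᵥ t) e ∧ (q : ℤ) + (N *ᵥ t) e ≤ (d * q : ℕ)) → W t = 0) :
    ∃ T : Finset (Fin r → ℤ), (∀ t ∉ T, W t = 0) ∧
      ∑ l ∈ admissibleVectors G (d * q), F (fun e => l e) = ∑ t ∈ T, W t := by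
  set ψ : (G.edgeSet → Fin (d * q + 1)) → Fin r → ℤ := fun l => M *ᵥ fun e => ((l e : ℕ) : ℤ) - q
    with hψ
  have hNψ : ∀ l ∈ admissibleVectors G (d * q), ∀ e, (N *ᵥ ψ l) e = ((l e : ℕ) : ℤ) - q :=
    fun l hl e => congrFun (mulVec_mulVec_eq_of_mem_admissibleVectors G hreg hsum hl) e
  refine ⟨(admissibleVectors G (d * q)).image ψ, fun t ht => ?_, ?_⟩
  · refine hW0 t fun hcond => ht (Finset.mem_image.2 ?_)
    have hlt : ∀ e, ((q : ℤ) + (N *ᵥ t) e).toNat < d * q + 1 := fun e => by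
      have := hcond e
      lia
    refine ⟨fun e => ⟨_, hlt e⟩, Finset.mem_filter.2 ⟨Finset.mem_univ _, fun v =>
      sum_ite_mem_toNat_eq G hreg hbip hBN (fun e => (hcond e).1) v⟩, ?_⟩
    have : (fun e => ((((q : ℤ) + (N *ᵥ t) e).toNat : ℕ) : ℤ) - q) = N *ᵥ t := by
      funext e
      rw [Int.toNat_of_nonneg (hcond e).1, add_sub_cancel_left]
    simp only [hψ]
    rw [this, Matrix.mulVec_mulVec, hMN, Matrix.one_mulVec]
  · rw [Finset.sum_image]
    · refine Finset.sum_congr rfl fun l hl => ?_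
      rw [hW (ψ l)]
      · congr 1
        funext e
        rw [hNψ l hl e, add_sub_cancel, Int.toNat_natCast]
      · intro e
        rw [hNψ l hl e, add_sub_cancel]
        have := (l e).is_lt
        lia
    · intro l hl l' hl' heq
      funext e
      have h1 := hNψ l hl e
      rw [heq, hNψ l' hl' e] at h1
      exact Fin.ext (by lia)

end lattice

lemma cast_mulVec {E ι : Type*} [Fintype ι] (N : Matrix E ι ℤ) (t : ι → ℤ) (e : E) :
    (((N *ᵥ t) e : ℤ) : ℝ) = (N.map (Int.castRingHom ℝ) *ᵥ fun i => (t i : ℝ)) e := by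
  simp [Matrix.mulVec, dotProduct]

lemma map_intCast_mul_eq_one {E ι : Type*} [Fintype E] [DecidableEq ι] {N : Matrix E ι ℤ}
    {M : Matrix ι E ℤ} (hMN : M * N = 1) :
    M.map (Int.castRingHom ℝ) * N.map (Int.castRingHom ℝ) = 1 := by
  rw [← Matrix.map_mul, hMN, Matrix.map_one _ (map_zero _) (map_one _)]

lemma exists_sum_sq_le_of_mul_eq_one {E ι : Type*} [Fintype E] [Fintype ι] [DecidableEq ι]
    {N : Matrix E ι ℤ} {M : Matrix ι E ℤ} (hMN : M * N = 1) :
    ∃ L : ℝ, 0 < L ∧ ∀ t : ι → ℤ, ∑ i, (t i : ℝ) ^ 2 ≤ L * ∑ e, (((N *ᵥ t) e : ℤ) : ℝ) ^ 2 := by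
  refine ⟨∑ i, ∑ e, (M i e : ℝ) ^ 2 + 1, by positivity, fun t => ?_⟩
  have h : ∀ i, (t i : ℝ) = ∑ e, (M i e : ℝ) * ((N *ᵥ t) e : ℤ) := fun i => by
    have h1 := congrFun (congrArg (· *ᵥ t) hMN) i
    simp only [← Matrix.mulVec_mulVec, Matrix.one_mulVec] at h1
    rw [← h1]
    simp only [Matrix.mulVec, dotProduct]
    push_cast
    rfl
  have h2 : 0 ≤ ∑ e, (((N *ᵥ t) e : ℤ) : ℝ) ^ 2 := by positivity
  calc ∑ i, (t i : ℝ) ^ 2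
      ≤ ∑ i, (∑ e, (M i e : ℝ) ^ 2) * ∑ e, (((N *ᵥ t) e : ℤ) : ℝ) ^ 2 :=
        Finset.sum_le_sum fun i _ => by
          rw [h i]
          exact Finset.sum_mul_sq_le_sq_mul_sq _ _ _
    _ ≤ _ := by
        rw [← Finset.sum_mul]
        nlinarith

/-- The sum of the normalized summands over admissible vectors is asymptotically a Gaussian
integral over the cycle space. -/
lemma exists_tendsto_sum_normalizedTerm {V : Type*} [Fintype V] [DecidableEq V]
    (G : SimpleGraph V) [DecidableRel G.Adj] {d : ℕ} (hd : 3 ≤ d) (hreg : G.IsRegularOfDegree d)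
    (hconn : G.Connected) (hbip : G.Colorable 2)
    (hcard : 2 * Fintype.card G.edgeSet = d * Fintype.card V) (v₀ : V) (z : ℤ) :
    ∃ r : ℕ, r + Fintype.card V = Fintype.card G.edgeSet + 1 ∧
      0 < (Matrix.of fun i j : {w : V // w ≠ v₀} =>
          (G.adjMatrix ℝ + (d : ℝ) • (1 : Matrix V V ℝ)) i.1 j.1).det ∧
      Tendsto (fun q : ℕ => (∑ l ∈ admissibleVectors G (d * q),
        normalizedTerm d z (d * q) fun e => l e) / √((d * q : ℕ) : ℝ) ^ r) atTop
        (𝓝 (√(π / ((d : ℝ) * (d - 2) / (2 * (d - 1)))) ^ r /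
          √(Matrix.of fun i j : {w : V // w ≠ v₀} =>
            (G.adjMatrix ℝ + (d : ℝ) • (1 : Matrix V V ℝ)) i.1 j.1).det)) := by
  classical
  have hd' : (3 : ℝ) ≤ d := by exact_mod_cast hd
  have hd0 : (0 : ℝ) < d := by linarith
  obtain ⟨r, N, M, C, hMN, hMC, hBN, hBC, hsum⟩ :=
    exists_split_of_surjective _ (reducedIncMatrix_surjective G hconn v₀)
  have hr : r + Fintype.card V = Fintype.card G.edgeSet + 1 := by
    have h := card_add_card_eq_of_split N M C _ hMN hBC hsum
    have hV : 0 < Fintype.card V := Fintype.card_pos_iff.2 ⟨v₀⟩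
    rw [Fintype.card_fin, Fintype.card_subtype_compl, Fintype.card_subtype_eq] at h
    lia
  set Nr : Matrix G.edgeSet (Fin r) ℝ := N.map (Int.castRingHom ℝ) with hNr
  have hQ : (Nrᵀ * Nr).PosDef := by
    have := Matrix.PosDef.conjTranspose_mul_self Nr
      (Function.LeftInverse.injective (g := (M.map (Int.castRingHom ℝ)).mulVec) fun x => by
        rw [Matrix.mulVec_mulVec, map_intCast_mul_eq_one hMN, Matrix.one_mulVec])
    rwa [Matrix.conjTranspose_eq_transpose_of_trivial] at this
  have hdet : (Nrᵀ * Nr).det = (Matrix.of fun i j : {w : V // w ≠ v₀} =>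
      (G.adjMatrix ℝ + (d : ℝ) • (1 : Matrix V V ℝ)) i.1 j.1).det := by
    rw [← map_reducedIncMatrix_mul_transpose G d hreg v₀, ← RingHom.mapMatrix_apply,
      ← RingHom.map_det, ← det_transpose_mul_self_eq_of_split N M C _ hMN hMC hBN hBC hsum,
      RingHom.map_det, RingHom.mapMatrix_apply, Matrix.map_mul, ← Matrix.transpose_map]
  refine ⟨r, hr, hdet ▸ hQ.det_pos, ?_⟩
  set b : ℝ := (d : ℝ) * (d - 2) / (2 * (d - 1)) with hb
  let cond : ℕ → (Fin r → ℤ) → Prop := fun q t =>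
    ∀ e, 0 ≤ (q : ℤ) + (N *ᵥ t) e ∧ (q : ℤ) + (N *ᵥ t) e ≤ (d * q : ℕ)
  let W : ℕ → (Fin r → ℤ) → ℝ := fun q t => if cond q t then
    normalizedTerm d z (d * q) (fun e => ((q : ℤ) + (N *ᵥ t) e).toNat) else 0
  have hT := fun q => exists_sum_admissibleVectors_eq G hreg hbip hMN hBN hsum q
    (normalizedTerm d z (d * q)) (W q) (fun t ht => if_pos ht) (fun t ht => if_neg ht)
  choose T hT0 hTsum using hT
  have hnN : Tendsto (fun q : ℕ => d * q) atTop atTop :=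
    tendsto_id.const_mul_atTop' (by lia)
  have hn : Tendsto (fun q : ℕ => ((d * q : ℕ) : ℝ)) atTop atTop :=
    tendsto_natCast_atTop_atTop.comp hnN
  have ha : Tendsto (fun q : ℕ => √((d * q : ℕ) : ℝ)) atTop atTop := tendsto_sqrt_atTop.comp hn
  have htoNat : ∀ q t, cond q t → ∀ e, ((((q : ℤ) + (N *ᵥ t) e).toNat : ℕ) : ℝ) - q =
      ((N *ᵥ t) e : ℤ) := fun q t ht e => by
    have h := Int.toNat_of_nonneg (ht e).1
    have h' : ((((q : ℤ) + (N *ᵥ t) e).toNat : ℕ) : ℝ) = q + ((N *ᵥ t) e : ℤ) := by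
      exact_mod_cast h
    rw [h', add_sub_cancel_left]
  have hlim : ∀ (t : ℕ → Fin r → ℤ) (s : Fin r → ℝ),
      (∀ i, Tendsto (fun q => (t q i : ℝ) / √((d * q : ℕ) : ℝ)) atTop (𝓝 (s i))) →
      Tendsto (fun q => W q (t q)) atTop (𝓝 (exp (-b * (s ⬝ᵥ (Nrᵀ * Nr) *ᵥ s)))) := by
    intro t s hts
    have hy : ∀ e, Tendsto (fun q => (((N *ᵥ t q) e : ℤ) : ℝ) / √((d * q : ℕ) : ℝ)) atTop
        (𝓝 ((Nr *ᵥ s) e)) := fun e => by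
      simp only [cast_mulVec]
      simp only [Matrix.mulVec, dotProduct, Finset.sum_div, mul_div_assoc]
      exact tendsto_finsetSum _ fun i _ => (hts i).const_mul _
    have hcond : ∀ᶠ q in atTop, cond q (t q) := by
      refine eventually_all.2 fun e => ?_
      have h0 := ((hy e).div_atTop ha).abs
      rw [abs_zero] at h0
      filter_upwards [h0.eventually_lt_const (show (0 : ℝ) < 1 / d by positivity),
        hn.eventually_gt_atTop 0] with q hq hq0
      rw [div_div, mul_self_sqrt hq0.le, abs_div, abs_of_pos hq0, div_lt_div_iff₀ hq0 hd0,
        one_mul] at hq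
      push_cast at hq
      rw [mul_comm, mul_lt_mul_iff_right₀ hd0] at hq
      have hq' : |(N *ᵥ t q) e| < q := by exact_mod_cast hq
      rw [abs_lt] at hq'
      have : 3 * q ≤ d * q := Nat.mul_le_mul_right q hd
      lia
    have hquad : s ⬝ᵥ (Nrᵀ * Nr) *ᵥ s = ∑ e, (Nr *ᵥ s) e ^ 2 := by
      rw [← Matrix.mulVec_mulVec, Matrix.dotProduct_mulVec, Matrix.vecMul_transpose]
      exact Finset.sum_congr rfl fun e _ => (sq _).symm
    rw [hquad]
    refine Tendsto.congr' (hcond.mono fun q hq => (if_pos hq).symm)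
      (tendsto_normalizedTerm hd z _ _ ?_ ?_ ?_)
    · exact hcond.mono fun q hq e => by have := hq e; lia
    · refine hcond.mono fun q hq => ?_
      rw [Finset.sum_congr rfl fun e _ => htoNat q _ hq e]
      exact_mod_cast sum_mulVec_eq_zero G hbip hBN (t q)
    · exact fun e => (hy e).congr' (hcond.mono fun q hq => by
        simp only [htoNat q _ hq e])
  obtain ⟨K, c, hc, hK⟩ := exists_normalizedTerm_le G hd hreg hcard z
  obtain ⟨L, hL, hsq⟩ := exists_sum_sq_le_of_mul_eq_one hMN
  have hbound : ∀ᶠ q : ℕ in atTop, ∀ t, |W q t| ≤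
      |K| * exp (-(c / L) * ∑ i, ((t i : ℝ) / √((d * q : ℕ) : ℝ)) ^ 2) := by
    filter_upwards [eventually_gt_atTop 0] with q hq t
    by_cases ht : cond q t
    · have hq' : (0 : ℝ) < q := by exact_mod_cast hq
      have hn0 : 0 < d * q := by positivity
      have hn0' : (0 : ℝ) < ((d * q : ℕ) : ℝ) := by exact_mod_cast hn0
      rw [show W q t = _ from if_pos ht]
      refine (hK (d * q) _ hn0 (fun e => by have := ht e; lia)
        (sum_ite_mem_toNat_eq G hreg hbip hBN fun e => (ht e).1)).trans ?_
      refine mul_le_mul (le_abs_self K) (exp_le_exp.2 ?_) (exp_pos _).le (abs_nonneg K)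
      have h1 : ∀ e, ((d * q : ℕ) : ℝ) *
          (((((q : ℤ) + (N *ᵥ t) e).toNat : ℕ) : ℝ) / (d * q : ℕ) - 1 / d) ^ 2 =
          (((N *ᵥ t) e : ℤ) : ℝ) ^ 2 / (d * q : ℕ) := fun e => by
        rw [← htoNat q t ht e]
        push_cast
        field_simp
      rw [Finset.sum_congr rfl fun e _ => h1 e, ← Finset.sum_div]
      simp only [div_pow, sq_sqrt hn0'.le]
      rw [← Finset.sum_div, neg_mul, neg_mul, neg_le_neg_iff]
      calc c / L * ((∑ i, (t i : ℝ) ^ 2) / (d * q : ℕ))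
          ≤ c / L * ((L * ∑ e, (((N *ᵥ t) e : ℤ) : ℝ) ^ 2) / (d * q : ℕ)) := by
            gcongr
            exact hsq t
        _ = _ := by field_simp
    · rw [show W q t = _ from if_neg ht, abs_zero]
      positivity
  have h := tendsto_lattice_sum _ ha W T hT0 _ hlim |K| (c / L) (by positivity) hbound
  rw [integral_exp_neg_mul_dotProduct_mulVec _ hQ, hdet, Fintype.card_fin] at h
  exact h.congr fun q => by rw [hTsum q]

end

open Nat in
open Classical in
/-- Let `G` be a finite connected bipartite `d`-regular simple graph
(`d ≥ 3`) with `g` vertices and `h = dg/2` edges, adjacency matrix `A`, and `A'` the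
matrix obtained by deleting the row and column of a fixed vertex `v₀`.  For `n ≥ 1` let
`S n = ∑_ℓ n!^{g−h} ∏_e (n−ℓ_e)!/ℓ_e!`, summed over integer vectors `0 ≤ ℓ_e ≤ n` with
`∑_{e∋v} ℓ_e = n` for all `v`.  Then, as `n → ∞` along multiples of `d`,
`S n ∼ [(d−1)^{(d−1)g/2+1/2}/((d(d−2))^{dg/4−g/2+1/2}·det(A'+dI')^{1/2})]·(2πn)^{1/2}
·((d−1)^{d−1}/d^{d−2})^{gn/2}`. -/
theorem stmt_9 {V : Type*} [Fintype V] [DecidableEq V] (G : SimpleGraph V)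
    [DecidableRel G.Adj] (d g h : ℕ) (hd : 3 ≤ d)
    (hreg : G.IsRegularOfDegree d)
    (hconn : G.Connected) (hbip : G.Colorable 2)
    (hg : Fintype.card V = g) (hh : Fintype.card G.edgeSet = h) (hdg : 2 * h = d * g)
    (v₀ : V)
    (S : ℕ → ℝ)
    (hS : ∀ n : ℕ, S n =
      ∑ ℓ ∈ Finset.univ.filter (fun ℓ : G.edgeSet → Fin (n + 1) =>
          ∀ v : V, (∑ e : G.edgeSet, if v ∈ (e : Sym2 V) then (ℓ e).val else 0) = n),
        (n ! : ℝ) ^ ((g : ℤ) - (h : ℤ)) *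
          ∏ e : G.edgeSet, ((n - (ℓ e).val)! : ℝ) / (((ℓ e).val)! : ℝ)) :
    Asymptotics.IsEquivalent (Filter.atTop ⊓ Filter.principal {n : ℕ | d ∣ n}) S
      (fun n =>
        ((d:ℝ) - 1) ^ (((d:ℝ) - 1) * g / 2 + 1/2) /
          (((d:ℝ) * ((d:ℝ) - 2)) ^ ((d:ℝ) * g / 4 - (g:ℝ) / 2 + 1/2) *
            Real.sqrt (Matrix.det (Matrix.of fun i j : {w : V // w ≠ v₀} =>
              (G.adjMatrix ℝ + (d:ℝ) • (1 : Matrix V V ℝ)) i.1 j.1))) *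
        Real.sqrt (2 * Real.pi * n) *
        ((((d:ℝ) - 1) ^ (d - 1) / (d:ℝ) ^ (d - 2)) ^ ((g:ℝ) * n / 2))) := by
  have hcard : 2 * Fintype.card G.edgeSet = d * Fintype.card V := by rw [hh, hg, hdg]
  obtain ⟨r, hr, hD, hlim⟩ :=
    exists_tendsto_sum_normalizedTerm G hd hreg hconn hbip hcard v₀ ((g : ℤ) - (h : ℤ))
  rw [hg, hh] at hr
  have hd' : (3 : ℝ) ≤ d := by exact_mod_cast hd
  have hpos1 : (0 : ℝ) < (d : ℝ) - 1 := by linarith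
  have hpos2 : (0 : ℝ) < (d : ℝ) - 2 := by linarith
  have hpos : (0 : ℝ) < d := by linarith
  have hv := fun n (hn : 0 < n) => centralTerm_mul_gaussian_eq (n := n) hd hn hdg hr
    (Matrix.of fun i j : {w : V // w ≠ v₀} =>
      (G.adjMatrix ℝ + (d : ℝ) • (1 : Matrix V V ℝ)) i.1 j.1).det
  refine isEquivalent_inf_principal_dvd (by lia) (fun n hn => ?_) ?_
  · have hn' : (0 : ℝ) < n := by exact_mod_cast hn
    have := Real.sqrt_pos.2 hD
    positivity
  · have hc : √(Real.pi / ((d : ℝ) * (d - 2) / (2 * (d - 1)))) ^ r /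
        √(Matrix.of fun i j : {w : V // w ≠ v₀} =>
          (G.adjMatrix ℝ + (d : ℝ) • (1 : Matrix V V ℝ)) i.1 j.1).det ≠ 0 := by
      have := Real.sqrt_pos.2 hD
      positivity
    have hlim' := hlim.div_const (√(Real.pi / ((d : ℝ) * (d - 2) / (2 * (d - 1)))) ^ r /
        √(Matrix.of fun i j : {w : V // w ≠ v₀} =>
          (G.adjMatrix ℝ + (d : ℝ) • (1 : Matrix V V ℝ)) i.1 j.1).det)
    rw [div_self hc] at hlim'
    refine hlim'.congr' ?_
    filter_upwards [Filter.eventually_gt_atTop 0] with q hq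
    have hn : 0 < d * q := by positivity
    have hn' : (0 : ℝ) < ((d * q : ℕ) : ℝ) := by exact_mod_cast hn
    have hC : centralTerm d ((g : ℤ) - (h : ℤ)) h (d * q) ≠ 0 := by
      have := Real.sqrt_pos.2 hpos1
      rw [centralTerm]
      positivity
    have hS' : S (d * q) = centralTerm d ((g : ℤ) - (h : ℤ)) h (d * q) *
        ∑ l ∈ admissibleVectors G (d * q),
          normalizedTerm d ((g : ℤ) - (h : ℤ)) (d * q) fun e => l e := by
      rw [hS, Finset.mul_sum]
      refine Finset.sum_congr rfl fun l hl => ?_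
      subst hh
      refine factorial_zpow_mul_prod_eq hd hn (fun e => (l e : ℕ))
        (fun e => Nat.lt_succ_iff.1 (l e).is_lt) ?_
      rw [← sum_sum_ite_mem_edge, Finset.sum_congr rfl fun v _ =>
        (show ∑ e : G.edgeSet, (if v ∈ (e : Sym2 V) then ((l e : ℕ) : ℝ) else 0) = (d * q : ℕ) by
          exact_mod_cast (Finset.mem_filter.1 hl).2 v), Finset.sum_const, Finset.card_univ, hg,
        nsmul_eq_mul]
    rw [← hv _ hn, hS', mul_assoc, mul_div_mul_left _ _ hC, div_div]
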